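/- There is an absolute constant c > 0 such that the following holds for Algorithm SSR. Assume k ≥ 2(bh+2)(h²+12)ℓ, let X be an (n, k)-source, let Y = Y¹∘⋯∘Y^N be an N × ⌊0.9k⌋ SR-source independent of X, and let S ⊆ [N] be a set such that Y^i is uniform on {0,1}^{⌊0.9k⌋} for every i ∈ S. Let Z = Z¹∘⋯∘Z^N = SSR(X, Y). Then for every S' ⊆ S with |S'| = h, the statistical distance |((Z^i)_{i∈S'}, Y) − (U_{hℓ}, Y)| ≤ c·b·h²·ε₂. -/

import Mathlib

open Finset

abbrev BitStr (n : ℕ) := Fin n → Bool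

/-- `p` is a probability distribution on the finite type `α`. -/
def IsProb {α : Type*} [Fintype α] (p : α → ℝ) : Prop :=
  (∀ a, 0 ≤ p a) ∧ ∑ a, p a = 1

/-- Statistical distance: `max_{T ⊆ α} |p(T) − q(T)|`. -/
noncomputable def statDist {α : Type*} [Fintype α] (p q : α → ℝ) : ℝ :=
  ⨆ T : Finset α, |∑ a ∈ T, p a - ∑ a ∈ T, q a|

/-- `H_∞(p) ≥ k`, i.e. every point has probability at most `2^(-k)`. -/
def IsKSource {α : Type*} [Fintype α] (p : α → ℝ) (k : ℝ) : Prop :=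
  ∀ a, p a ≤ (2 : ℝ) ^ (-k)

/-- The uniform distribution on a finite type. -/
noncomputable def unif (α : Type*) [Fintype α] : α → ℝ := fun _ => (Fintype.card α : ℝ)⁻¹


/-- `Ext` is a strong `(k, ε)` seeded extractor. -/
def IsStrongSeededExtractor {n d m : ℕ} (Ext : BitStr n → BitStr d → BitStr m)
    (k ε : ℝ) : Prop :=
  ∀ p : BitStr n → ℝ, IsProb p → IsKSource p k →
    statDist
      (fun z : BitStr m × BitStr d =>
        (∑ x : BitStr n, if Ext x z.2 = z.1 then p x else 0) * unif (BitStr d) z.2)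
      (fun z => unif (BitStr m) z.1 * unif (BitStr d) z.2) ≤ ε

/-- The first `m` bits of a bit string (padding with `false` if needed). -/
def truncate {r : ℕ} (m : ℕ) (y : BitStr r) : BitStr m :=
  fun i => if h : (i : ℕ) < r then y ⟨i, h⟩ else false

/-- Alternating extraction: `laS … j` is `S_{j+1}`. -/
def laS {n nq ℓ : ℕ} (Extq : BitStr nq → BitStr ℓ → BitStr ℓ)
    (Extw : BitStr n → BitStr ℓ → BitStr ℓ)
    (x : BitStr n) (q : BitStr nq) (s₁ : BitStr ℓ) : ℕ → BitStr ℓ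
  | 0 => s₁
  | j + 1 => Extq q (Extw x (laS Extq Extw x q s₁ j))

/-- `laR … j` is `R_{j+1}`; the look-ahead extractor is `(laR … 0, …, laR … (t−1))`. -/
def laR {n nq ℓ : ℕ} (Extq : BitStr nq → BitStr ℓ → BitStr ℓ)
    (Extw : BitStr n → BitStr ℓ → BitStr ℓ)
    (x : BitStr n) (q : BitStr nq) (s₁ : BitStr ℓ) (j : ℕ) : BitStr ℓ :=
  Extw x (laS Extq Extw x q s₁ j)

/-- Write `v` in binary with `d` bits, split the bits from left (most significant) to
right into `b` blocks of `l` bits each, padding the last block with `0`s; `blockVal`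
returns the value of block `j` (`0`-indexed), i.e. `Ind_{i,j+1} − 1`. -/
def blockVal (d l b : ℕ) (v : ℕ) (j : ℕ) : ℕ :=
  v * 2 ^ (b * l - d) / 2 ^ ((b - 1 - j) * l) % 2 ^ l

/-- Algorithm `SSR(X, Y)` from \cite{Li13b}: for each row `i`, starting from the first
`M` bits of `Y^i`, run `b` rounds of look-ahead extraction against `X`, each time
selecting the output indexed by the corresponding block of the binary expression of
the row index, and using it as a seed to extract the next `Q`-part from `Y^i`;
the row output `Z^i` is the selected output of the last round. -/
def SSR {n rl ℓ M N : ℕ} (d l b : ℕ)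
    (Extq : BitStr M → BitStr ℓ → BitStr ℓ) (Extw : BitStr n → BitStr ℓ → BitStr ℓ)
    (Ext : BitStr rl → BitStr ℓ → BitStr M)
    (x : BitStr n) (Y : Fin N → BitStr rl) : Fin N → BitStr ℓ :=
  fun i =>
    let Yj : ℕ → BitStr M := fun j =>
      Nat.rec (truncate M (Y i))
        (fun j' prev =>
          Ext (Y i) (laR Extq Extw x prev (truncate ℓ prev) (blockVal d l b (i : ℕ) j')))
        j
    laR Extq Extw x (Yj (b - 1)) (truncate ℓ (Yj (b - 1))) (blockVal d l b (i : ℕ) (b - 1))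

section StatBasics

lemma sum_pos_le_of_statDist {α : Type*} [Fintype α] (p q : α → ℝ) (ε : ℝ)
    (hs : statDist p q ≤ ε) : ∑ a, max (p a - q a) 0 ≤ ε := by
  classical
  have hb : BddAbove (Set.range fun T : Finset α => |∑ a ∈ T, p a - ∑ a ∈ T, q a|) :=
    (Set.finite_range _).bddAbove
  have h1 := le_ciSup hb (univ.filter fun a => q a ≤ p a)
  refine le_trans ?_ (le_trans h1 hs)
  refine le_trans ?_ (le_abs_self _)
  rw [← Finset.sum_sub_distrib, Finset.sum_filter]
  apply Finset.sum_le_sum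
  intro a _
  split_ifs with hh
  · rw [max_eq_left (by linarith)]
  · rw [max_eq_right (by linarith)]

lemma statDist_le_of_sum_pos {α : Type*} [Fintype α] (p q : α → ℝ) (ε : ℝ)
    (hpq : ∑ a, p a = ∑ a, q a) (hs : ∑ a, max (p a - q a) 0 ≤ ε) : statDist p q ≤ ε := by
  classical
  have key : ∀ T : Finset α, ∑ a ∈ T, p a - ∑ a ∈ T, q a ≤ ε := by
    intro T
    rw [← Finset.sum_sub_distrib]
    calc ∑ a ∈ T, (p a - q a) ≤ ∑ a ∈ T, max (p a - q a) 0 :=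
          Finset.sum_le_sum fun a _ => le_max_left _ _
      _ ≤ ∑ a, max (p a - q a) 0 :=
          Finset.sum_le_univ_sum_of_nonneg fun a => le_max_right _ _
      _ ≤ ε := hs
  unfold statDist
  apply ciSup_le
  intro T
  rw [abs_le]
  refine ⟨?_, key T⟩
  have h1 := key Tᶜ
  have h2 := Finset.sum_add_sum_compl T p
  have h3 := Finset.sum_add_sum_compl T q
  linarith

/-- Total excess of the output of an extractor over uniform (averaged over the seed), for an
unnormalised weight function. -/
noncomputable def extErr {n d m : ℕ} (E : BitStr n → BitStr d → BitStr m) (p : BitStr n → ℝ) : ℝ :=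
  ∑ z : BitStr m × BitStr d, max ((∑ x, if E x z.2 = z.1 then p x else 0) * unif (BitStr d) z.2
    - (∑ x, p x) * (unif (BitStr m) z.1 * unif (BitStr d) z.2)) 0

variable {n d m : ℕ} (E : BitStr n → BitStr d → BitStr m)

lemma extErr_nonneg (p : BitStr n → ℝ) : 0 ≤ extErr E p :=
  Finset.sum_nonneg fun _ _ => le_max_right _ _

lemma extErr_smul (p : BitStr n → ℝ) (c : ℝ) (hc : 0 ≤ c) :
    extErr E (fun x => c * p x) = c * extErr E p := by
  unfold extErr
  rw [Finset.mul_sum]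
  apply Finset.sum_congr rfl
  intro z _
  have : (∑ x, if E x z.2 = z.1 then c * p x else 0)
      = c * ∑ x, if E x z.2 = z.1 then p x else 0 := by
    rw [Finset.mul_sum]; apply Finset.sum_congr rfl; intro x _; split_ifs <;> simp
  rw [this, ← Finset.mul_sum]
  have h0 : max (c * ((∑ x, if E x z.2 = z.1 then p x else 0) * unif (BitStr d) z.2
    - (∑ x, p x) * (unif (BitStr m) z.1 * unif (BitStr d) z.2))) (c * 0) = 
    c * max ((∑ x, if E x z.2 = z.1 then p x else 0) * unif (BitStr d) z.2
    - (∑ x, p x) * (unif (BitStr m) z.1 * unif (BitStr d) z.2)) 0 :=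
    (mul_max_of_nonneg _ _ hc).symm
  rw [← h0, mul_zero]
  congr 1; ring

lemma sum_unif (α : Type*) [Fintype α] [Nonempty α] : ∑ a : α, unif α a = 1 := by
  unfold unif
  simp

lemma extErr_inner_sum (p : BitStr n → ℝ) :
    ∑ z : BitStr m × BitStr d, ((∑ x, if E x z.2 = z.1 then p x else 0) * unif (BitStr d) z.2
    - (∑ x, p x) * (unif (BitStr m) z.1 * unif (BitStr d) z.2)) = 0 := by
  rw [Finset.sum_sub_distrib, ← Finset.mul_sum]
  have h1 : ∑ z : BitStr m × BitStr d, unif (BitStr m) z.1 * unif (BitStr d) z.2 = 1 := by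
    rw [Fintype.sum_prod_type]
    simp only
    simp_rw [← Finset.mul_sum]
    rw [sum_unif]; simp [sum_unif]
  have h2 : ∑ z : BitStr m × BitStr d, (∑ x, if E x z.2 = z.1 then p x else 0) * unif (BitStr d) z.2
      = ∑ x, p x := by
    rw [Fintype.sum_prod_type_right]
    simp only
    have : ∀ s : BitStr d, ∑ z : BitStr m, (∑ x, if E x s = z then p x else 0) * unif (BitStr d) s
        = (∑ x, p x) * unif (BitStr d) s := by
      intro s
      rw [← Finset.sum_mul, Finset.sum_comm]
      simp
    simp_rw [this]
    rw [← Finset.mul_sum, sum_unif, mul_one]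
  rw [h1, h2]; ring

lemma extErr_sub (p q : BitStr n → ℝ) :
    extErr E p ≤ extErr E (fun x => p x + q x) + extErr E q := by
  have hq : extErr E q = ∑ z : BitStr m × BitStr d,
      max (-((∑ x, if E x z.2 = z.1 then q x else 0) * unif (BitStr d) z.2
    - (∑ x, q x) * (unif (BitStr m) z.1 * unif (BitStr d) z.2))) 0 := by
    rw [← sub_eq_zero, extErr, ← Finset.sum_sub_distrib]
    refine Eq.trans ?_ (extErr_inner_sum E q)
    apply Finset.sum_congr rfl
    intro z _
    generalize (∑ x, if E x z.2 = z.1 then q x else 0) * unif (BitStr d) z.2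
    - (∑ x, q x) * (unif (BitStr m) z.1 * unif (BitStr d) z.2) = t
    rcases le_total 0 t with h | h
    · rw [max_eq_left h, max_eq_right (by linarith)]; ring
    · rw [max_eq_right h, max_eq_left (by linarith)]; ring
  rw [hq]
  unfold extErr
  rw [← Finset.sum_add_distrib]
  apply Finset.sum_le_sum
  intro z _
  have h1 : (∑ x, if E x z.2 = z.1 then p x + q x else 0) =
    (∑ x, if E x z.2 = z.1 then p x else 0) + ∑ x, if E x z.2 = z.1 then q x else 0 := by
    rw [← Finset.sum_add_distrib]; apply Finset.sum_congr rfl; intro x _; split_ifs <;> simp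
  rw [h1, Finset.sum_add_distrib]
  apply max_le
  · refine le_trans (le_of_eq ?_) (add_le_add (le_max_left _ _) (le_max_left _ _))
    ring
  · exact add_nonneg (le_max_right _ _) (le_max_right _ _)

lemma extErr_le_of_source {K : ℕ} {ε : ℝ} (hE : IsStrongSeededExtractor E (K : ℝ) ε)
    (p : BitStr n → ℝ) (hp : ∀ x, 0 ≤ p x) (c : ℝ) (hc : ∀ x, p x ≤ c)
    (hm : 2 ^ K * c ≤ ∑ x, p x) (hpos : 0 < ∑ x, p x) : extErr E p ≤ ε * ∑ x, p x := by
  set μ := ∑ x, p x with hμ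
  have h2 : (fun x => μ * (μ⁻¹ * p x)) = p := by
    funext x; field_simp
  have hsum : ∑ x, μ⁻¹ * p x = 1 := by
    rw [← Finset.mul_sum, ← hμ]; field_simp
  have h3 := hE (fun x => μ⁻¹ * p x) ⟨fun x => mul_nonneg (by positivity) (hp x), hsum⟩ (by
    intro x
    rw [Real.rpow_neg (by norm_num), Real.rpow_natCast]
    show μ⁻¹ * p x ≤ (2 ^ K)⁻¹
    rw [inv_mul_le_iff₀ hpos, ← div_eq_mul_inv, le_div_iff₀ (by positivity)]
    have := hc x
    have h4 : p x * 2 ^ K ≤ c * 2 ^ K := by gcongr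
    linarith)
  have h5 := sum_pos_le_of_statDist _ _ _ h3
  have h6 : extErr E (fun x => μ⁻¹ * p x) ≤ ε := by
    refine le_trans (le_of_eq ?_) h5
    unfold extErr
    rw [hsum]
    simp
  rw [← h2, extErr_smul E _ _ hpos.le]
  nlinarith

lemma eps_nonneg {K : ℕ} {ε : ℝ} (hE : IsStrongSeededExtractor E (K : ℝ) ε) (hK : K ≤ n) :
    0 ≤ ε := by
  have h := extErr_le_of_source E hE (fun _ => 1) (fun _ => zero_le_one) 1 (fun _ => le_rfl)
    (by simp; exact pow_le_pow_right₀ (by norm_num) hK) (by simp)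
  have h2 := extErr_nonneg E (fun _ => 1)
  have h3 : 0 ≤ ε * ∑ x : BitStr n, (1:ℝ) := h2.trans h
  have h4 : (0:ℝ) < ∑ x : BitStr n, (1:ℝ) := by simp
  exact nonneg_of_mul_nonneg_left h3 h4

lemma extErr_le {K : ℕ} {ε : ℝ} (hE : IsStrongSeededExtractor E (K : ℝ) ε) (hK : K + 1 ≤ n)
    (p : BitStr n → ℝ) (hp : ∀ x, 0 ≤ p x) (c : ℝ) (hc : ∀ x, p x ≤ c) :
    extErr E p ≤ ε * (∑ x, p x + 2 * (2 ^ K * c)) := by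
  have hε : 0 ≤ ε := eps_nonneg E hE (by omega)
  set μ := ∑ x, p x with hμ
  have hμ0 : 0 ≤ μ := Finset.sum_nonneg fun x _ => hp x
  have hc0 : 0 ≤ c := (hp (fun _ => false)).trans (hc _)
  rcases eq_or_lt_of_le hc0 with h0 | hcpos
  · have hpz : p = fun x => 0 * p x := by
      funext x
      have := hp x; have := hc x; simp; linarith
    rw [hpz, extErr_smul E p 0 le_rfl]
    have : 0 ≤ 2 * (2 ^ K * c) := by positivity
    simp only [zero_mul]
    exact mul_nonneg hε (by linarith)
  have hKp : (0:ℝ) < 2 ^ K := by positivity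
  rcases le_or_gt (2 ^ K * c) μ with h1 | h1
  · have hpos : 0 < μ := lt_of_lt_of_le (by positivity) h1
    refine (extErr_le_of_source E hE p hp c hc h1 hpos).trans ?_
    have : 0 ≤ 2 * (2 ^ K * c) := by positivity
    gcongr
    linarith
  · have hn : (2:ℝ) * 2 ^ K ≤ 2 ^ n := by
      have := pow_le_pow_right₀ (a := (2:ℝ)) (by norm_num) hK
      rw [pow_succ] at this; linarith
    have hnc : 2 * (2 ^ K * c) ≤ 2 ^ n * c := by nlinarith
    have hden : 0 < 2 ^ n * c - μ := by nlinarith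
    set θ := (2 ^ K * c - μ) / (2 ^ n * c - μ) with hθ
    have hθ0 : 0 < θ := div_pos (by linarith) hden
    have hθ1 : θ ≤ 1 := by rw [hθ, div_le_one hden]; nlinarith
    have hθm : θ * (2 ^ n * c - μ) = 2 ^ K * c - μ := div_mul_cancel₀ _ hden.ne'
    have hsq : ∑ x : BitStr n, θ * (c - p x) = 2 ^ K * c - μ := by
      rw [← Finset.mul_sum, Finset.sum_sub_distrib, ← hμ, ← hθm]; simp
    have hspq : ∑ x : BitStr n, (p x + θ * (c - p x)) = 2 ^ K * c := by
      rw [Finset.sum_add_distrib, hsq, ← hμ]; ring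
    have e1 := extErr_le_of_source E hE (fun x => p x + θ * (c - p x))
      (fun x => by
        have := hp x; have := hc x
        have : 0 ≤ θ * (c - p x) := mul_nonneg hθ0.le (by linarith)
        linarith) c
      (fun x => by
        have := hp x; have := hc x
        nlinarith) (by rw [hspq]) (by rw [hspq]; positivity)
    have e2 := extErr_le_of_source E hE (fun x => θ * (c - p x))
      (fun x => by
        have := hc x
        exact mul_nonneg hθ0.le (by linarith)) (θ * c)
      (fun x => by
        have := hp x
        nlinarith) (by
        rw [hsq, ← hθm]
        nlinarith) (by rw [hsq]; linarith)
    rw [hspq] at e1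
    rw [hsq] at e2
    have e3 := extErr_sub E p (fun x => θ * (c - p x))
    nlinarith

lemma extErr_eq (p : BitStr n → ℝ) : extErr E p = ∑ r : BitStr d, (Fintype.card (BitStr d) : ℝ)⁻¹ *
    ∑ z : BitStr m, max ((∑ x, if E x r = z then p x else 0)
      - (Fintype.card (BitStr m) : ℝ)⁻¹ * ∑ x, p x) 0 := by
  unfold extErr
  rw [Fintype.sum_prod_type_right]
  apply Finset.sum_congr rfl
  intro r _
  rw [Finset.mul_sum]
  apply Finset.sum_congr rfl
  intro z _
  have h0 : (0:ℝ) ≤ (Fintype.card (BitStr d) : ℝ)⁻¹ := by positivity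
  rw [mul_max_of_nonneg _ _ h0, mul_zero]
  unfold unif
  congr 1
  ring

end StatBasics
section Protocol

set_option linter.unusedSectionVars false

/-- A finite family of (weighted) rectangles, with nominal masses. -/
structure St (X Y : Type) where
  V : Type
  fin : Fintype V
  A : V → X → ℝ
  B : V → Y → ℝ
  a : V → ℝ
  b : V → ℝ

attribute [instance] St.fin

variable {X Y : Type} [Fintype X] [Fintype Y]

def St.swap (s : St X Y) : St Y X := ⟨s.V, s.fin, s.B, s.A, s.b, s.a⟩

structure St.Good (s : St X Y) (pX : X → ℝ) (pY : Y → ℝ) (δ : ℝ) : Prop where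
  A_nn : ∀ v x, 0 ≤ s.A v x
  B_nn : ∀ v y, 0 ≤ s.B v y
  hA : ∀ v, ∑ x, s.A v x ≤ s.a v
  hB : ∀ v, ∑ y, s.B v y ≤ s.b v
  dom : ∀ x y, ∑ v, s.A v x * s.B v y ≤ pX x * pY y
  nom : ∑ v, s.a v * s.b v ≤ 1
  mass : 1 - δ ≤ ∑ v, (∑ x, s.A v x) * (∑ y, s.B v y)

lemma St.Good.swap {s : St X Y} {pX pY δ} (h : s.Good pX pY δ) : s.swap.Good pY pX δ where
  A_nn := h.B_nn
  B_nn := h.A_nn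
  hA := h.hB
  hB := h.hA
  dom := fun x y => by
    have := h.dom y x
    rw [mul_comm (pY x)]
    refine le_trans (le_of_eq ?_) this
    exact Finset.sum_congr rfl fun v _ => mul_comm _ _
  nom := le_trans (le_of_eq (Finset.sum_congr rfl fun v _ => mul_comm _ _)) h.nom
  mass := le_trans h.mass (le_of_eq (Finset.sum_congr rfl fun v _ => mul_comm _ _))

lemma St.Good.mono {s : St X Y} {pX pY δ δ'} (h : s.Good pX pY δ) (hd : δ ≤ δ') :
    s.Good pX pY δ' :=
  { h with mass := by have := h.mass; linarith }

lemma St.Good.a_nn {s : St X Y} {pX pY δ} (h : s.Good pX pY δ) (v) : 0 ≤ s.a v :=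
  (Finset.sum_nonneg fun x _ => h.A_nn v x).trans (h.hA v)

lemma St.Good.b_nn {s : St X Y} {pX pY δ} (h : s.Good pX pY δ) (v) : 0 ≤ s.b v :=
  (Finset.sum_nonneg fun x _ => h.B_nn v x).trans (h.hB v)

def KnY (s : St X Y) {γ : Type} (F : X → Y → γ) : Prop :=
  ∃ f : s.V → Y → γ, ∀ v x y, s.A v x ≠ 0 → s.B v y ≠ 0 → F x y = f v y

def KnX (s : St X Y) {γ : Type} (F : X → Y → γ) : Prop :=
  KnY s.swap (fun y x => F x y)

def Kn (s : St X Y) {γ : Type} (F : X → Y → γ) : Prop :=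
  ∃ f : s.V → γ, ∀ v x y, s.A v x ≠ 0 → s.B v y ≠ 0 → F x y = f v

lemma Kn.swap {s : St X Y} {γ : Type} {F : X → Y → γ} (h : Kn s F) :
    Kn s.swap (fun y x => F x y) := by
  obtain ⟨f, hf⟩ := h
  exact ⟨f, fun v y x hy hx => hf v x y hx hy⟩

lemma Kn.knY {s : St X Y} {γ : Type} {F : X → Y → γ} (h : Kn s F) : KnY s F := by
  obtain ⟨f, hf⟩ := h
  exact ⟨fun v _ => f v, hf⟩

lemma Kn.knX {s : St X Y} {γ : Type} {F : X → Y → γ} (h : Kn s F) : KnX s F :=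
  h.swap.knY

lemma knY_of (s : St X Y) {γ : Type} (f : Y → γ) : KnY s (fun _ y => f y) :=
  ⟨fun _ y => f y, fun _ _ _ _ _ => rfl⟩

lemma knX_of (s : St X Y) {γ : Type} (f : X → γ) : KnX s (fun x _ => f x) :=
  ⟨fun _ y => f y, fun _ _ _ _ _ => rfl⟩

lemma kn_const (s : St X Y) {γ : Type} (c : γ) : Kn s (fun _ _ => c) :=
  ⟨fun _ => c, fun _ _ _ _ _ => rfl⟩

lemma KnY.map {s : St X Y} {γ γ' : Type} {F : X → Y → γ} (h : KnY s F) (g : γ → γ') :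
    KnY s (fun x y => g (F x y)) := by
  obtain ⟨f, hf⟩ := h
  exact ⟨fun v y => g (f v y), fun v x y hx hy => by simp only [hf v x y hx hy]⟩

lemma KnY.map₂ {s : St X Y} {γ γ' γ'' : Type} {F : X → Y → γ} {G : X → Y → γ'} (h : KnY s F)
    (h' : KnY s G) (g : γ → γ' → γ'') :
    KnY s (fun x y => g (F x y) (G x y)) := by
  obtain ⟨f, hf⟩ := h
  obtain ⟨f', hf'⟩ := h'
  exact ⟨fun v y => g (f v y) (f' v y),
    fun v x y hx hy => by simp only [hf v x y hx hy, hf' v x y hx hy]⟩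

lemma KnX.map₂ {s : St X Y} {γ γ' γ'' : Type} {F : X → Y → γ} {G : X → Y → γ'} (h : KnX s F)
    (h' : KnX s G) (g : γ → γ' → γ'') :
    KnX s (fun x y => g (F x y) (G x y)) :=
  KnY.map₂ (s := s.swap) h h' g

lemma Kn.map {s : St X Y} {γ γ' : Type} {F : X → Y → γ} (h : Kn s F) (g : γ → γ') :
    Kn s (fun x y => g (F x y)) := by
  obtain ⟨f, hf⟩ := h
  exact ⟨fun v => g (f v), fun v x y hx hy => by simp only [hf v x y hx hy]⟩

lemma KnY.pi {s : St X Y} {ι γ : Type} {F : ι → X → Y → γ} (h : ∀ i, KnY s (F i)) :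
    KnY s (fun x y i => F i x y) := by
  choose f hf using h
  exact ⟨fun v y i => f i v y, fun v x y hx hy => funext fun i => hf i v x y hx hy⟩

lemma KnX.pi {s : St X Y} {ι γ : Type} {F : ι → X → Y → γ} (h : ∀ i, KnX s (F i)) :
    KnX s (fun x y i => F i x y) :=
  KnY.pi (s := s.swap) h

def EntY (s : St X Y) {γ : Type} [DecidableEq γ] (F : X → Y → γ) (κ : ℝ) : Prop :=
  ∃ (f : s.V → Y → γ) (m : s.V → ℝ),
    (∀ v x y, s.A v x ≠ 0 → s.B v y ≠ 0 → F x y = f v y) ∧ (∀ v, 0 ≤ m v) ∧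
    (∀ v z, ∑ y, (if f v y = z then s.B v y else 0) ≤ m v) ∧ ∑ v, s.a v * m v ≤ κ

def EntX (s : St X Y) {γ : Type} [DecidableEq γ] (F : X → Y → γ) (κ : ℝ) : Prop :=
  EntY s.swap (fun y x => F x y) κ

def UnifY (s : St X Y) {γ : Type} [DecidableEq γ] [Fintype γ] (F : X → Y → γ) : Prop :=
  ∃ (f : s.V → Y → γ),
    (∀ v x y, s.A v x ≠ 0 → s.B v y ≠ 0 → F x y = f v y) ∧
    (∀ v z, ∑ y, (if f v y = z then s.B v y else 0) ≤ (Fintype.card γ : ℝ)⁻¹ * s.b v)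

def UnifX (s : St X Y) {γ : Type} [DecidableEq γ] [Fintype γ] (F : X → Y → γ) : Prop :=
  UnifY s.swap (fun y x => F x y)

lemma UnifY.knY {s : St X Y} {γ : Type} [DecidableEq γ] [Fintype γ] {F : X → Y → γ}
    (h : UnifY s F) : KnY s F := by
  obtain ⟨f, hf, _⟩ := h
  exact ⟨f, hf⟩

lemma UnifY.entY {s : St X Y} {pX pY δ} (hg : s.Good pX pY δ)
    {γ : Type} [DecidableEq γ] [Fintype γ] {F : X → Y → γ}
    (h : UnifY s F) : EntY s F (Fintype.card γ : ℝ)⁻¹ := by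
  obtain ⟨f, hf, hb⟩ := h
  refine ⟨f, fun v => (Fintype.card γ : ℝ)⁻¹ * s.b v, hf, fun v => ?_, hb, ?_⟩
  · exact mul_nonneg (by positivity) (hg.b_nn v)
  · have : ∑ v, s.a v * ((Fintype.card γ : ℝ)⁻¹ * s.b v)
        = (Fintype.card γ : ℝ)⁻¹ * ∑ v, s.a v * s.b v := by
      rw [Finset.mul_sum]; exact Finset.sum_congr rfl fun v _ => by ring
    rw [this]
    have h0 : (0:ℝ) ≤ (Fintype.card γ : ℝ)⁻¹ := by positivity
    nlinarith [hg.nom]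

lemma EntY.mono {s : St X Y} {γ : Type} [DecidableEq γ] {F : X → Y → γ} {κ κ' : ℝ}
    (h : EntY s F κ) (hk : κ ≤ κ') : EntY s F κ' := by
  obtain ⟨f, m, h1, h2, h3, h4⟩ := h
  exact ⟨f, m, h1, h2, h3, h4.trans hk⟩

/-- Pushing a uniform variable through a regular map. -/
lemma UnifY.map {s : St X Y} {pX pY δ} (hg : s.Good pX pY δ)
    {γ γ' : Type} [DecidableEq γ] [Fintype γ] [DecidableEq γ'] [Fintype γ'] {F : X → Y → γ}
    (h : UnifY s F) (g : γ → γ')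
    (hreg : ∀ z, ((univ.filter fun w => g w = z).card : ℝ) * (Fintype.card γ : ℝ)⁻¹
      ≤ (Fintype.card γ' : ℝ)⁻¹) :
    UnifY s (fun x y => g (F x y)) := by
  obtain ⟨f, hf, hb⟩ := h
  refine ⟨fun v y => g (f v y), fun v x y hx hy => by simp only [hf v x y hx hy], fun v z => ?_⟩
  have h1 : ∑ y, (if g (f v y) = z then s.B v y else 0)
      = ∑ w ∈ univ.filter (fun w => g w = z), ∑ y, (if f v y = w then s.B v y else 0) := by
    rw [Finset.sum_comm]
    apply Finset.sum_congr rfl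
    intro y _
    rw [Finset.sum_ite_eq]
    simp
  rw [h1]
  calc _ ≤ ∑ w ∈ univ.filter (fun w => g w = z), (Fintype.card γ : ℝ)⁻¹ * s.b v :=
        Finset.sum_le_sum fun w _ => hb v w
    _ = (((univ.filter fun w => g w = z).card : ℝ) * (Fintype.card γ : ℝ)⁻¹) * s.b v := by
        rw [Finset.sum_const, nsmul_eq_mul]; ring
    _ ≤ _ := mul_le_mul_of_nonneg_right (hreg z) (hg.b_nn v)

/-- The second state refines the first, at entropy cost factors `cX`, `cY`. -/
structure Ref (s s' : St X Y) (cX cY : ℝ) : Prop where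
  kn : ∀ {γ : Type} {F : X → Y → γ}, Kn s F → Kn s' F
  knX : ∀ {γ : Type} {F : X → Y → γ}, KnX s F → KnX s' F
  knY : ∀ {γ : Type} {F : X → Y → γ}, KnY s F → KnY s' F
  entX : ∀ {γ : Type} [DecidableEq γ] {F : X → Y → γ} {κ : ℝ}, EntX s F κ → EntX s' F (cX * κ)
  entY : ∀ {γ : Type} [DecidableEq γ] {F : X → Y → γ} {κ : ℝ}, EntY s F κ → EntY s' F (cY * κ)

lemma Ref.swap {s s' : St X Y} {cX cY : ℝ} (h : Ref s s' cX cY) : Ref s.swap s'.swap cY cX where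
  kn := fun hk => (h.kn hk.swap).swap
  knX := fun hk => h.knY hk
  knY := fun hk => h.knX hk
  entX := fun hk => h.entY hk
  entY := fun hk => h.entX hk

lemma entY_ref (s s' : St X Y) (π : s'.V → s.V) (hA0 : ∀ v x, 0 ≤ s'.A v x)
    (hB0 : ∀ v x, 0 ≤ s'.B v x)
    (hA : ∀ v x, s'.A v x ≤ s.A (π v) x) (hB : ∀ v y, s'.B v y ≤ s.B (π v) y) (cY : ℝ)
    (hc : 0 ≤ cY)
    (ha : ∀ m : s.V → ℝ, (∀ v, 0 ≤ m v) → ∑ v, s'.a v * m (π v) ≤ cY * ∑ v, s.a v * m v)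
    {γ : Type} [DecidableEq γ] {F : X → Y → γ} {κ : ℝ} (h : EntY s F κ) :
    EntY s' F (cY * κ) := by
  obtain ⟨f, m, h1, h2, h3, h4⟩ := h
  refine ⟨fun v => f (π v), fun v => m (π v), fun v x y hx hy => ?_, fun v => h2 _,
    fun v z => ?_, ?_⟩
  · apply h1
    · have := hA0 v x; have := hA v x
      intro h; rw [h] at this; exact hx (by linarith)
    · have := hB0 v y; have := hB v y
      intro h; rw [h] at this; exact hy (by linarith)
  · refine le_trans (Finset.sum_le_sum fun y _ => ?_) (h3 (π v) z)
    split_ifs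
    · exact hB v y
    · exact le_rfl
  · exact (ha m h2).trans (mul_le_mul_of_nonneg_left h4 hc)

lemma knY_ref (s s' : St X Y) (π : s'.V → s.V) (hA0 : ∀ v x, 0 ≤ s'.A v x)
    (hB0 : ∀ v x, 0 ≤ s'.B v x)
    (hA : ∀ v x, s'.A v x ≤ s.A (π v) x) (hB : ∀ v y, s'.B v y ≤ s.B (π v) y)
    {γ : Type} {F : X → Y → γ} (h : KnY s F) : KnY s' F := by
  obtain ⟨f, h1⟩ := h
  refine ⟨fun v => f (π v), fun v x y hx hy => ?_⟩
  apply h1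
  · have := hA0 v x; have := hA v x
    intro h; rw [h] at this; exact hx (by linarith)
  · have := hB0 v y; have := hB v y
    intro h; rw [h] at this; exact hy (by linarith)

lemma ref_of (s s' : St X Y) (π : s'.V → s.V) (hA0 : ∀ v x, 0 ≤ s'.A v x)
    (hB0 : ∀ v x, 0 ≤ s'.B v x)
    (hA : ∀ v x, s'.A v x ≤ s.A (π v) x) (hB : ∀ v y, s'.B v y ≤ s.B (π v) y) (cX cY : ℝ)
    (hcX : 0 ≤ cX) (hcY : 0 ≤ cY)
    (ha : ∀ m : s.V → ℝ, (∀ v, 0 ≤ m v) → ∑ v, s'.a v * m (π v) ≤ cY * ∑ v, s.a v * m v)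
    (hb : ∀ m : s.V → ℝ, (∀ v, 0 ≤ m v) → ∑ v, s'.b v * m (π v) ≤ cX * ∑ v, s.b v * m v) :
    Ref s s' cX cY where
  kn := by
    intro γ F h
    obtain ⟨f, h1⟩ := h
    refine ⟨fun v => f (π v), fun v x y hx hy => ?_⟩
    apply h1
    · have := hA0 v x; have := hA v x
      intro h; rw [h] at this; exact hx (by linarith)
    · have := hB0 v y; have := hB v y
      intro h; rw [h] at this; exact hy (by linarith)
  knX := fun h => knY_ref s.swap s'.swap π hB0 hA0 hB hA h
  knY := fun h => knY_ref s s' π hA0 hB0 hA hB h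
  entX := fun h => entY_ref s.swap s'.swap π hB0 hA0 hB hA cX hcX hb h
  entY := fun h => entY_ref s s' π hA0 hB0 hA hB cY hcY ha h

lemma sum_fib {α γ : Type} [Fintype α] [Fintype γ] [DecidableEq γ] (f : α → γ) (B : α → ℝ) :
    ∑ z, ∑ y, (if f y = z then B y else 0) = ∑ y, B y := by
  rw [Finset.sum_comm]; simp

/-- Reveal a `Y`-side function. -/
lemma revealY {s : St X Y} {pX pY δ} (hg : s.Good pX pY δ) {γ : Type} [DecidableEq γ] [Fintype γ]
    {G : X → Y → γ} (hG : KnY s G) :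
    ∃ s' : St X Y, s'.Good pX pY δ ∧ Kn s' G ∧ Ref s s' 1 (Fintype.card γ) ∧
      ∀ {β : Type} [DecidableEq β] [Fintype β] {F : X → Y → β}, UnifX s F → UnifX s' F := by
  obtain ⟨f, hf⟩ := hG
  let s' : St X Y := 
    { V := s.V × γ
      fin := inferInstance
      A := fun v => s.A v.1
      B := fun v y => if f v.1 y = v.2 then s.B v.1 y else 0
      a := fun v => s.a v.1
      b := fun v => ∑ y, if f v.1 y = v.2 then s.B v.1 y else 0 }
  have hB0 : ∀ v y, 0 ≤ s'.B v y := by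
    intro v y
    show 0 ≤ if f v.1 y = v.2 then s.B v.1 y else 0
    split_ifs
    · exact hg.B_nn _ _
    · exact le_rfl
  have hBle : ∀ v y, s'.B v y ≤ s.B v.1 y := by
    intro v y
    show (if f v.1 y = v.2 then s.B v.1 y else 0) ≤ _
    split_ifs
    · exact le_rfl
    · exact hg.B_nn _ _
  have hA0 : ∀ v x, 0 ≤ s'.A v x := fun v x => hg.A_nn _ _
  refine ⟨s', ⟨hA0, hB0, fun v => hg.hA _, fun v => le_rfl, ?_, ?_, ?_⟩, ?_, ?_, ?_⟩
  · intro x y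
    refine le_trans (le_of_eq ?_) (hg.dom x y)
    show ∑ v : s.V × γ, s.A v.1 x * (if f v.1 y = v.2 then s.B v.1 y else 0) = _
    rw [Fintype.sum_prod_type]
    simp
  · refine le_trans ?_ hg.nom
    show ∑ v : s.V × γ, s.a v.1 * (∑ y, if f v.1 y = v.2 then s.B v.1 y else 0) ≤ _
    rw [Fintype.sum_prod_type]
    apply Finset.sum_le_sum
    intro v _
    simp only
    rw [← Finset.mul_sum, sum_fib]
    exact mul_le_mul_of_nonneg_left (hg.hB v) (hg.a_nn v)
  · refine le_trans hg.mass (le_of_eq ?_)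
    show _ = ∑ v : s.V × γ, (∑ x, s.A v.1 x) * (∑ y, if f v.1 y = v.2 then s.B v.1 y else 0)
    rw [Fintype.sum_prod_type]
    apply Finset.sum_congr rfl
    intro v _
    simp only
    rw [← Finset.mul_sum, sum_fib]
  · refine ⟨fun v => v.2, fun v x y hx hy => ?_⟩
    have hy' : (if f v.1 y = v.2 then s.B v.1 y else 0) ≠ 0 := hy
    split_ifs at hy' with hh
    · rw [hf v.1 x y hx hy', hh]
    · exact absurd rfl hy'
  · refine ref_of s s' (fun v => v.1) hA0 hB0 (fun v x => le_rfl) hBle 1 _ zero_le_one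
      (by positivity) ?_ ?_
    · intro m hm
      show ∑ v : s.V × γ, s.a v.1 * m v.1 ≤ _
      rw [Fintype.sum_prod_type, Finset.mul_sum]
      simp
    · intro m hm
      show ∑ v : s.V × γ, (∑ y, if f v.1 y = v.2 then s.B v.1 y else 0) * m v.1 ≤ _
      rw [Fintype.sum_prod_type, one_mul]
      apply Finset.sum_le_sum
      intro v _
      simp only
      rw [← Finset.sum_mul, sum_fib]
      exact mul_le_mul_of_nonneg_right (hg.hB v) (hm v)
  · intro β _ _ F hF
    obtain ⟨g, h1, h2⟩ := hF
    refine ⟨fun v => g v.1, fun v y x hy hx => ?_, fun v z => h2 v.1 z⟩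
    refine h1 v.1 y x ?_ hx
    have hy' : (if f v.1 y = v.2 then s.B v.1 y else 0) ≠ 0 := hy
    split_ifs at hy' with hh
    · exact hy'
    · exact absurd rfl hy'

lemma revealX {s : St X Y} {pX pY δ} (hg : s.Good pX pY δ) {γ : Type} [DecidableEq γ] [Fintype γ]
    {G : X → Y → γ} (hG : KnX s G) :
    ∃ s' : St X Y, s'.Good pX pY δ ∧ Kn s' G ∧ Ref s s' (Fintype.card γ) 1 ∧
      ∀ {β : Type} [DecidableEq β] [Fintype β] {F : X → Y → β}, UnifY s F → UnifY s' F := by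
  obtain ⟨s', h1, h2, h3, h4⟩ := revealY hg.swap hG
  exact ⟨s'.swap, h1.swap, h2.swap, h3.swap, fun h => h4 h⟩

/-- Remove the excess mass over a threshold in each fibre. -/
lemma carve {α γ : Type} [Fintype α] [Fintype γ] [DecidableEq γ] (f : α → γ) (B : α → ℝ)
    (hB : ∀ y, 0 ≤ B y) (t : ℝ) (ht : 0 ≤ t) :
    ∃ B' : α → ℝ, (∀ y, 0 ≤ B' y) ∧ (∀ y, B' y ≤ B y) ∧
      (∀ z, ∑ y, (if f y = z then B' y else 0) ≤ t) ∧
      ∑ y, B y - ∑ z, max ((∑ y, if f y = z then B y else 0) - t) 0 ≤ ∑ y, B' y := by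
  set c : γ → ℝ := fun z => ∑ y, if f y = z then B y else 0 with hc
  set w : γ → ℝ := fun z => if c z ≤ t then 1 else t / c z with hw
  have hw0 : ∀ z, 0 ≤ w z := by
    intro z
    simp only [hw]
    split_ifs with h
    · exact zero_le_one
    · exact div_nonneg ht (by linarith)
  have hw1 : ∀ z, w z ≤ 1 := by
    intro z
    simp only [hw]
    split_ifs with h
    · exact le_rfl
    · rw [div_le_one (by linarith)]; linarith
  have hcw : ∀ z, ∑ y, (if f y = z then B y * w (f y) else 0) = c z * w z := by
    intro z
    simp only [hc]
    rw [Finset.sum_mul]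
    apply Finset.sum_congr rfl
    intro y _
    split_ifs with h
    · rw [h]
    · simp
  have hcw2 : ∀ z, c z * w z ≤ t ∧ c z - max (c z - t) 0 ≤ c z * w z := by
    intro z
    simp only [hw]
    split_ifs with h
    · constructor
      · linarith
      · have := le_max_right (c z - t) 0; linarith
    · have h1 : c z * (t / c z) = t := by
        rw [mul_div_cancel₀]; linarith
      rw [h1]
      refine ⟨le_rfl, ?_⟩
      have := le_max_left (c z - t) 0; linarith
  refine ⟨fun y => B y * w (f y), fun y => mul_nonneg (hB y) (hw0 _),
    fun y => mul_le_of_le_one_right (hB y) (hw1 _), fun z => ?_, ?_⟩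
  · rw [hcw]; exact (hcw2 z).1
  · rw [← sum_fib f B, ← sum_fib f (fun y => B y * w (f y)), ← Finset.sum_sub_distrib]
    apply Finset.sum_le_sum
    intro z _
    rw [hcw]
    exact (hcw2 z).2

/-- Extract from a `Y`-side entropy source with an `X`-side uniform seed. -/
lemma extractY {n d m K : ℕ} {E : BitStr n → BitStr d → BitStr m} {ε : ℝ}
    (hE : IsStrongSeededExtractor E (K : ℝ) ε) (hK : K + 1 ≤ n)
    {s : St X Y} {pX pY δ} (hg : s.Good pX pY δ)
    {R : X → Y → BitStr d} (hR : UnifX s R) {Q : X → Y → BitStr n} {κ : ℝ} (hQ : EntY s Q κ)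
    (hκ : 2 ^ K * κ ≤ 1) :
    ∃ s' : St X Y, s'.Good pX pY (δ + 3 * ε) ∧ Kn s' R ∧ Ref s s' (2 ^ d) 1 ∧
      UnifY s' (fun x y => E (Q x y) (R x y)) := by
  have hε : 0 ≤ ε := eps_nonneg E hE (by omega)
  obtain ⟨g, hg1, hg2⟩ := hR
  obtain ⟨f, mm, hf1, hm0, hf2, hf3⟩ := hQ
  have hcarve : ∀ v : s.V × BitStr d, _ := fun v =>
    carve (fun y => E (f v.1 y) v.2) (s.B v.1) (hg.B_nn v.1)
      ((Fintype.card (BitStr m) : ℝ)⁻¹ * ∑ y, s.B v.1 y)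
      (mul_nonneg (by positivity) (Finset.sum_nonneg fun y _ => hg.B_nn v.1 y))
  choose B' hB0 hBle hBt hBm using hcarve
  have hcd : (0:ℝ) ≤ (Fintype.card (BitStr d) : ℝ)⁻¹ := by positivity
  let s' : St X Y :=
    { V := s.V × BitStr d
      fin := inferInstance
      A := fun v x => if g v.1 x = v.2 then s.A v.1 x else 0
      B := B'
      a := fun v => (Fintype.card (BitStr d) : ℝ)⁻¹ * s.a v.1
      b := fun v => s.b v.1 }
  have hA0 : ∀ v x, 0 ≤ s'.A v x := by
    intro v y
    show 0 ≤ if g v.1 y = v.2 then s.A v.1 y else 0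
    split_ifs
    · exact hg.A_nn _ _
    · exact le_rfl
  have hAle : ∀ v y, s'.A v y ≤ s.A v.1 y := by
    intro v y
    show (if g v.1 y = v.2 then s.A v.1 y else 0) ≤ _
    split_ifs
    · exact le_rfl
    · exact hg.A_nn _ _
  have hA' : ∀ v, ∑ x, s'.A v x ≤ (Fintype.card (BitStr d) : ℝ)⁻¹ * s.a v.1 := fun v => hg2 v.1 v.2
  have hcard : ∀ t : ℝ, ∑ _r : BitStr d, (Fintype.card (BitStr d) : ℝ)⁻¹ * t = t := by
    intro t
    simp
  refine ⟨s', ⟨hA0, hB0, hA', ?_, ?_, ?_, ?_⟩, ?_, ?_, ?_⟩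
  · intro v
    exact (Finset.sum_le_sum fun y _ => hBle v y).trans (hg.hB v.1)
  · intro x y
    refine le_trans ?_ (hg.dom x y)
    show ∑ v : s.V × BitStr d, (if g v.1 x = v.2 then s.A v.1 x else 0) * B' v y ≤ _
    rw [Fintype.sum_prod_type]
    apply Finset.sum_le_sum
    intro v _
    calc _ ≤ ∑ r : BitStr d, (if g v x = r then s.A v x else 0) * s.B v y := by
          apply Finset.sum_le_sum
          intro r _
          exact mul_le_mul_of_nonneg_left (hBle (v, r) y) (hA0 (v, r) x)
      _ = _ := by rw [← Finset.sum_mul]; simp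
  · refine le_trans (le_of_eq ?_) hg.nom
    show ∑ v : s.V × BitStr d, ((Fintype.card (BitStr d) : ℝ)⁻¹ * s.a v.1) * s.b v.1 = _
    rw [Fintype.sum_prod_type]
    apply Finset.sum_congr rfl
    intro v _
    simp only [mul_assoc]
    exact hcard _
  · -- mass
    let exc : s.V → BitStr d → ℝ := fun v r =>
      ∑ z : BitStr m, max ((∑ y, if E (f v y) r = z then s.B v y else 0)
        - (Fintype.card (BitStr m) : ℝ)⁻¹ * ∑ y, s.B v y) 0
    have hexc0 : ∀ v r, 0 ≤ exc v r := fun v r => Finset.sum_nonneg fun _ _ => le_max_right _ _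
    have hexc : ∀ v, ∑ r, (Fintype.card (BitStr d) : ℝ)⁻¹ * exc v r
        ≤ ε * (∑ y, s.B v y + 2 * (2 ^ K * mm v)) := by
      intro v
      have h1 := extErr_le E hE hK (fun q => ∑ y, if f v y = q then s.B v y else 0)
        (fun q => Finset.sum_nonneg fun y _ => by
          split_ifs
          · exact hg.B_nn _ _
          · exact le_rfl) (mm v) (fun q => hf2 v q)
      rw [extErr_eq, sum_fib] at h1
      refine le_trans (le_of_eq ?_) h1
      apply Finset.sum_congr rfl
      intro r _
      congr 1
      apply Finset.sum_congr rfl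
      intro z _
      congr 2
      have : ∀ q, (if E q r = z then ∑ y, (if f v y = q then s.B v y else 0) else 0)
          = ∑ y, (if f v y = q then (if E (f v y) r = z then s.B v y else 0) else 0) := by
        intro q
        split_ifs with h
        · apply Finset.sum_congr rfl
          intro y _
          split_ifs with h1 h2
          · rfl
          · rw [h1] at h2; exact absurd h h2
          · rfl
        · symm
          apply Finset.sum_eq_zero
          intro y _
          split_ifs with h1 h2
          · rw [h1] at h2; exact absurd h2 h
          · rfl
          · rfl
      simp_rw [this]
      rw [sum_fib]
    have h1 : ∀ v, (∑ x, s.A v x) * (∑ y, s.B v y)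
        - s.a v * (ε * (∑ y, s.B v y + 2 * (2 ^ K * mm v)))
        ≤ ∑ r : BitStr d, (∑ x, s'.A (v, r) x) * (∑ y, B' (v, r) y) := by
      intro v
      have h2 : ∀ r : BitStr d, (∑ x, s'.A (v, r) x) * (∑ y, s.B v y)
          - s.a v * ((Fintype.card (BitStr d) : ℝ)⁻¹ * exc v r)
          ≤ (∑ x, s'.A (v, r) x) * (∑ y, B' (v, r) y) := by
        intro r
        have e1 : (∑ x, s'.A (v, r) x) * exc v r
            ≤ ((Fintype.card (BitStr d) : ℝ)⁻¹ * s.a v) * exc v r :=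
          mul_le_mul_of_nonneg_right (hA' (v, r)) (hexc0 v r)
        have e2 : (∑ x, s'.A (v, r) x) * ((∑ y, s.B v y) - exc v r)
            ≤ (∑ x, s'.A (v, r) x) * (∑ y, B' (v, r) y) :=
          mul_le_mul_of_nonneg_left (hBm (v, r)) (Finset.sum_nonneg fun x _ => hA0 (v, r) x)
        nlinarith
      have h3 := Finset.sum_le_sum fun r (_ : r ∈ univ) => h2 r
      refine le_trans ?_ h3
      rw [Finset.sum_sub_distrib, ← Finset.sum_mul, ← Finset.mul_sum]
      have h4 : ∑ r : BitStr d, ∑ x, s'.A (v, r) x = ∑ x, s.A v x := sum_fib (g v) (s.A v)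
      rw [h4]
      have := mul_le_mul_of_nonneg_left (hexc v) (hg.a_nn v)
      linarith
    show _ ≤ ∑ v : s.V × BitStr d, (∑ x, s'.A v x) * (∑ y, B' v y)
    rw [Fintype.sum_prod_type]
    refine le_trans ?_ (Finset.sum_le_sum fun v _ => h1 v)
    rw [Finset.sum_sub_distrib]
    have h5 : ∑ v, s.a v * (ε * (∑ y, s.B v y + 2 * (2 ^ K * mm v)))
        ≤ ε * (1 + 2 * 1) := by
      have h6 : ∑ v, s.a v * (ε * (∑ y, s.B v y + 2 * (2 ^ K * mm v)))
        = ε * (∑ v, s.a v * (∑ y, s.B v y) + 2 * (2 ^ K * ∑ v, s.a v * mm v)) := by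
        simp only [Finset.mul_sum, ← Finset.sum_add_distrib]
        apply Finset.sum_congr rfl
        intro v _
        rw [mul_add, ← Finset.mul_sum]
        ring
      rw [h6]
      apply mul_le_mul_of_nonneg_left _ hε
      have h7 : ∑ v, s.a v * (∑ y, s.B v y) ≤ 1 :=
        (Finset.sum_le_sum fun v _ => mul_le_mul_of_nonneg_left (hg.hB v) (hg.a_nn v)).trans hg.nom
      have h8 : 2 ^ K * ∑ v, s.a v * mm v ≤ 1 :=
        (mul_le_mul_of_nonneg_left hf3 (by positivity)).trans hκ
      linarith
    have := hg.mass
    linarith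
  · refine ⟨fun v => v.2, fun v x y hx hy => ?_⟩
    have hx' : (if g v.1 x = v.2 then s.A v.1 x else 0) ≠ 0 := hx
    have hy' : s.B v.1 y ≠ 0 := by
      intro h0
      have h1 := hBle v y
      have h2 := hB0 v y
      rw [h0] at h1
      exact hy (le_antisymm h1 h2)
    split_ifs at hx' with hh
    · exact (hg1 v.1 y x hy' hx').trans hh
    · exact absurd rfl hx'
  · refine ref_of s s' (fun v => v.1) hA0 hB0 hAle hBle _ 1 (by positivity) zero_le_one ?_ ?_
    · intro m _
      show ∑ v : s.V × BitStr d, ((Fintype.card (BitStr d) : ℝ)⁻¹ * s.a v.1) * m v.1 ≤ _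
      rw [Fintype.sum_prod_type, one_mul]
      apply Finset.sum_le_sum
      intro v _
      simp only [mul_assoc]
      exact (hcard _).le
    · intro m _
      show ∑ v : s.V × BitStr d, s.b v.1 * m v.1 ≤ _
      rw [Fintype.sum_prod_type, Finset.mul_sum]
      simp
  · refine ⟨fun v y => E (f v.1 y) v.2, fun v x y hx hy => ?_, fun v z => ?_⟩
    · have hx' : (if g v.1 x = v.2 then s.A v.1 x else 0) ≠ 0 := hx
      have hy' : s.B v.1 y ≠ 0 := by
        intro h0
        have h1 := hBle v y
        have h2 := hB0 v y
        rw [h0] at h1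
        exact hy (le_antisymm h1 h2)
      split_ifs at hx' with hh
      · have e1 : R x y = g v.1 x := hg1 v.1 y x hy' hx'
        have e2 : Q x y = f v.1 y := hf1 v.1 x y hx' hy'
        simp only [e1, e2, hh]
      · exact absurd rfl hx'
    · refine (hBt v z).trans ?_
      exact mul_le_mul_of_nonneg_left (hg.hB v.1) (by positivity)

lemma extractX {n d m K : ℕ} {E : BitStr n → BitStr d → BitStr m} {ε : ℝ}
    (hE : IsStrongSeededExtractor E (K : ℝ) ε) (hK : K + 1 ≤ n)
    {s : St X Y} {pX pY δ} (hg : s.Good pX pY δ)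
    {R : X → Y → BitStr d} (hR : UnifY s R) {Q : X → Y → BitStr n} {κ : ℝ} (hQ : EntX s Q κ)
    (hκ : 2 ^ K * κ ≤ 1) :
    ∃ s' : St X Y, s'.Good pX pY (δ + 3 * ε) ∧ Kn s' R ∧ Ref s s' 1 (2 ^ d) ∧
      UnifX s' (fun x y => E (Q x y) (R x y)) := by
  obtain ⟨s', h1, h2, h3, h4⟩ := extractY hE hK (s := s.swap) hg.swap
    (R := fun y x => R x y) hR (Q := fun y x => Q x y) hQ hκ
  exact ⟨s'.swap, h1.swap, h2.swap, h3.swap, h4⟩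

lemma count_pi {ι Γ : Type} [Fintype ι] [DecidableEq ι] [Fintype Γ] [DecidableEq Γ] [Nonempty Γ]
    (T : Finset ι) (w : ι → Γ) :
    ∑ z : ι → Γ, (if ∀ i ∈ T, w i = z i then ((Fintype.card Γ : ℝ) ^ T.card) else 0)
      = (Fintype.card Γ : ℝ) ^ Fintype.card ι := by
  have h1 : (univ.filter fun z : ι → Γ => ∀ i ∈ T, w i = z i)
      = Fintype.piFinset (fun i => if i ∈ T then {w i} else univ) := by
    ext z
    simp only [Finset.mem_filter, Finset.mem_univ, true_and, Fintype.mem_piFinset]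
    constructor
    · intro h i
      split_ifs with hi
      · simp [h i hi]
      · simp
    · intro h i hi
      have := h i
      rw [if_pos hi] at this
      exact (Finset.mem_singleton.mp this).symm
  have h2 : (univ.filter fun z : ι → Γ => ∀ i ∈ T, w i = z i).card
      = Fintype.card Γ ^ (Fintype.card ι - T.card) := by
    rw [h1, Fintype.card_piFinset]
    have : ∀ i, (if i ∈ T then ({w i} : Finset Γ) else univ).card
        = if i ∈ T then 1 else Fintype.card Γ := by
      intro i; split_ifs <;> simp
    simp_rw [this]
    rw [Finset.prod_ite]
    simp only [Finset.prod_const, one_pow, one_mul]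
    congr 1
    rw [Finset.filter_not, Finset.card_sdiff]
    simp
  rw [← Finset.sum_filter, Finset.sum_const, h2, nsmul_eq_mul]
  push_cast
  rw [← pow_add, Nat.sub_add_cancel (Finset.card_le_univ T)]

/-- Joint weight of the event that the outputs in `T` agree with `z` and `Y = y`. -/
noncomputable def jointP {ι Γ : Type} [DecidableEq Γ] (pX : X → ℝ) (pY : Y → ℝ)
    (Z : ι → X → Y → Γ) (T : Finset ι) (z : ι → Γ) (y : Y) : ℝ :=
  ∑ x, if ∀ i ∈ T, Z i x y = z i then pX x * pY y else 0

lemma hybrid_step {ι Γ : Type} [Fintype ι] [DecidableEq ι] [Fintype Γ] [DecidableEq Γ] [Nonempty Γ]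
    {pX : X → ℝ} {pY : Y → ℝ} (hX : ∑ x, pX x = 1) (hY : ∑ y, pY y = 1)
    {s : St X Y} {δ : ℝ} (hg : s.Good pX pY δ) (Z : ι → X → Y → Γ) (T : Finset ι) (i0 : ι)
    (hi0 : i0 ∉ T) (hT : ∀ i ∈ T, Kn s (Z i)) (hU : UnifX s (Z i0)) :
    ∑ z : ι → Γ, ∑ y, max ((Fintype.card Γ : ℝ) ^ (insert i0 T).card * jointP pX pY Z (insert i0 T) z y
      - (Fintype.card Γ : ℝ) ^ T.card * jointP pX pY Z T z y) 0
    ≤ (Fintype.card Γ : ℝ) ^ Fintype.card ι * (2 * δ) := by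
  have hkn : Kn s (fun x y (i : {i // i ∈ T}) => Z i x y) := by
    choose f hf using hT
    exact ⟨fun v i => f i.1 i.2 v, fun v x y hx hy => funext fun i => hf i.1 i.2 v x y hx hy⟩
  obtain ⟨fT, hfT⟩ := hkn
  obtain ⟨g, hg1, hg2⟩ := hU
  let f : s.V → ι → Γ := fun v i => if h : i ∈ T then fT v ⟨i, h⟩ else Classical.arbitrary Γ
  have hf : ∀ v x y, s.A v x ≠ 0 → s.B v y ≠ 0 → ∀ i ∈ T, Z i x y = f v i := by
    intro v x y hx hy i hi
    have := congrFun (hfT v x y hx hy) ⟨i, hi⟩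
    simp only [f, dif_pos hi]
    exact this
  set q : ℝ := ((Fintype.card Γ : ℕ) : ℝ) with hq
  have hqpos : 0 < q := by rw [hq]; exact_mod_cast Fintype.card_pos
  let L : X → Y → ℝ := fun x y => pX x * pY y - ∑ v, s.A v x * s.B v y
  have hL0 : ∀ x y, 0 ≤ L x y := fun x y => by have := hg.dom x y; simp only [L]; linarith
  have hLs : ∑ y, ∑ x, L x y ≤ δ := by
    have h1 : ∑ y, ∑ x, L x y = 1 - ∑ v, (∑ x, s.A v x) * (∑ y, s.B v y) := by
      simp only [L, Finset.sum_sub_distrib]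
      congr 1
      · simp_rw [← Finset.sum_mul]
        rw [hX]; simpa using hY
      · have : ∀ y, ∑ x, ∑ v, s.A v x * s.B v y = ∑ v, (∑ x, s.A v x) * s.B v y := by
          intro y
          rw [Finset.sum_comm]
          simp_rw [Finset.sum_mul]
        simp_rw [this]
        rw [Finset.sum_comm]
        simp_rw [Finset.mul_sum]
    have := hg.mass
    linarith
  have hWs : ∑ v, (s.a v - ∑ x, s.A v x) * (∑ y, s.B v y) ≤ δ := by
    have h1 : ∑ v, (s.a v - ∑ x, s.A v x) * (∑ y, s.B v y) =
        ∑ v, s.a v * (∑ y, s.B v y) - ∑ v, (∑ x, s.A v x) * (∑ y, s.B v y) := by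
      rw [← Finset.sum_sub_distrib]
      exact Finset.sum_congr rfl fun v _ => by ring
    have h7 : ∑ v, s.a v * (∑ y, s.B v y) ≤ 1 :=
        (Finset.sum_le_sum fun v _ => mul_le_mul_of_nonneg_left (hg.hB v) (hg.a_nn v)).trans hg.nom
    have := hg.mass
    linarith
  -- pointwise bound
  have hpt : ∀ z y, max (q ^ (insert i0 T).card * jointP pX pY Z (insert i0 T) z y
      - q ^ T.card * jointP pX pY Z T z y) 0
      ≤ (∑ x, L x y * (if ∀ i ∈ insert i0 T, Z i x y = z i then q ^ (insert i0 T).card else 0))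
        + ∑ v, (s.a v - ∑ x, s.A v x) * s.B v y * (if ∀ i ∈ T, f v i = z i then q ^ T.card else 0) := by
    intro z y
    have hn1 : 0 ≤ ∑ x, L x y * (if ∀ i ∈ insert i0 T, Z i x y = z i then q ^ (insert i0 T).card else 0) := by
      apply Finset.sum_nonneg
      intro x _
      apply mul_nonneg (hL0 x y)
      split_ifs <;> positivity
    have hn2 : 0 ≤ ∑ v, (s.a v - ∑ x, s.A v x) * s.B v y * (if ∀ i ∈ T, f v i = z i then q ^ T.card else 0) := by
      apply Finset.sum_nonneg
      intro v _
      apply mul_nonneg (mul_nonneg (by have := hg.hA v; linarith) (hg.B_nn v y))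
      split_ifs <;> positivity
    apply max_le _ (add_nonneg hn1 hn2)
    -- upper bound for the first term
    have hu : jointP pX pY Z (insert i0 T) z y ≤
        (∑ x, L x y * (if ∀ i ∈ insert i0 T, Z i x y = z i then 1 else 0))
        + q⁻¹ * ∑ v, s.a v * s.B v y * (if ∀ i ∈ T, f v i = z i then 1 else 0) := by
      have e1 : jointP pX pY Z (insert i0 T) z y =
        (∑ x, L x y * (if ∀ i ∈ insert i0 T, Z i x y = z i then 1 else 0))
        + ∑ v, ∑ x, s.A v x * s.B v y * (if ∀ i ∈ insert i0 T, Z i x y = z i then 1 else 0) := by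
        unfold jointP
        rw [Finset.sum_comm (s := (univ : Finset s.V)), ← Finset.sum_add_distrib]
        apply Finset.sum_congr rfl
        intro x _
        rw [← Finset.sum_mul]
        simp only [L]
        split_ifs
        · ring
        · ring
      rw [e1, Finset.mul_sum]
      gcongr with v _
      by_cases hB : s.B v y = 0
      · simp [hB]
      have hBp : 0 ≤ s.B v y := hg.B_nn v y
      by_cases hc : ∀ i ∈ T, f v i = z i
      · rw [if_pos hc]
        have h2 := hg2 v (z i0)
        calc _ ≤ ∑ x, (if g v x = z i0 then s.A v x else 0) * s.B v y := by
              apply Finset.sum_le_sum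
              intro x _
              by_cases hA : s.A v x = 0
              · simp [hA]
              have hAp : 0 ≤ s.A v x := hg.A_nn v x
              split_ifs with c1 c2 c2
              · simp
              · exfalso; apply c2
                rw [← hg1 v y x hB hA]
                exact c1 i0 (Finset.mem_insert_self _ _)
              · simp; positivity
              · simp
          _ = (∑ x, (if g v x = z i0 then s.A v x else 0)) * s.B v y := by rw [Finset.sum_mul]
          _ ≤ (q⁻¹ * s.a v) * s.B v y := mul_le_mul_of_nonneg_right h2 hBp
          _ = _ := by ring
      · rw [if_neg hc, mul_zero, mul_zero]
        apply le_of_eq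
        apply Finset.sum_eq_zero
        intro x _
        by_cases hA : s.A v x = 0
        · simp [hA]
        rw [if_neg, mul_zero]
        intro hh
        apply hc
        intro i hi
        rw [← hf v x y hA hB i hi]
        exact hh i (Finset.mem_insert_of_mem hi)
    have hl : ∑ v, (∑ x, s.A v x) * s.B v y * (if ∀ i ∈ T, f v i = z i then 1 else 0)
        ≤ jointP pX pY Z T z y := by
      have e1 : ∑ v, (∑ x, s.A v x) * s.B v y * (if ∀ i ∈ T, f v i = z i then 1 else 0)
          = ∑ x, ∑ v, s.A v x * s.B v y * (if ∀ i ∈ T, f v i = z i then 1 else 0) := by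
        rw [Finset.sum_comm]
        simp_rw [Finset.sum_mul]
      rw [e1]
      unfold jointP
      apply Finset.sum_le_sum
      intro x _
      have e2 : ∀ v, s.A v x * s.B v y * (if ∀ i ∈ T, f v i = z i then 1 else 0)
          = s.A v x * s.B v y * (if ∀ i ∈ T, Z i x y = z i then 1 else 0) := by
        intro v
        by_cases hA : s.A v x = 0
        · simp [hA]
        by_cases hB : s.B v y = 0
        · simp [hB]
        congr 1
        have : (∀ i ∈ T, f v i = z i) ↔ (∀ i ∈ T, Z i x y = z i) := by
          constructor
          · intro h i hi; rw [hf v x y hA hB i hi]; exact h i hi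
          · intro h i hi; rw [← hf v x y hA hB i hi]; exact h i hi
        simp only [this]
      simp_rw [e2]
      rw [← Finset.sum_mul]
      split_ifs
      · rw [mul_one]; exact hg.dom x y
      · simp
    have hci : (insert i0 T).card = T.card + 1 := Finset.card_insert_of_notMem hi0
    have r1 : (∑ x, L x y * (if ∀ i ∈ insert i0 T, Z i x y = z i then q ^ (insert i0 T).card else 0))
        = q ^ (insert i0 T).card *
          ∑ x, L x y * (if ∀ i ∈ insert i0 T, Z i x y = z i then 1 else 0) := by
      rw [Finset.mul_sum]; apply Finset.sum_congr rfl; intro x _; split_ifs <;> ring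
    have r2 : ∑ v, (s.a v - ∑ x, s.A v x) * s.B v y * (if ∀ i ∈ T, f v i = z i then q ^ T.card else 0)
        = q ^ T.card * (∑ v, s.a v * s.B v y * (if ∀ i ∈ T, f v i = z i then 1 else 0))
         - q ^ T.card * ∑ v, (∑ x, s.A v x) * s.B v y * (if ∀ i ∈ T, f v i = z i then 1 else 0) := by
      rw [← mul_sub, ← Finset.sum_sub_distrib, Finset.mul_sum]
      apply Finset.sum_congr rfl; intro x _; split_ifs <;> ring
    rw [r1, r2]
    have m1 := mul_le_mul_of_nonneg_left hu (pow_nonneg hqpos.le (insert i0 T).card)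
    have m2 := mul_le_mul_of_nonneg_left hl (pow_nonneg hqpos.le T.card)
    have m3 : q ^ (insert i0 T).card * (q⁻¹ * ∑ v, s.a v * s.B v y * (if ∀ i ∈ T, f v i = z i then 1 else 0))
        = q ^ T.card * ∑ v, s.a v * s.B v y * (if ∀ i ∈ T, f v i = z i then 1 else 0) := by
      rw [hci, pow_succ]; field_simp
    rw [mul_add, m3] at m1
    linarith
  refine (Finset.sum_le_sum fun z _ => Finset.sum_le_sum fun y _ => hpt z y).trans ?_
  simp only [Finset.sum_add_distrib]
  have t1 : ∑ z : ι → Γ, ∑ y, ∑ x, L x y * (if ∀ i ∈ insert i0 T, Z i x y = z i then q ^ (insert i0 T).card else 0)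
      = q ^ Fintype.card ι * ∑ y, ∑ x, L x y := by
    rw [Finset.sum_comm, Finset.mul_sum]
    apply Finset.sum_congr rfl
    intro y _
    rw [Finset.sum_comm, Finset.mul_sum]
    apply Finset.sum_congr rfl
    intro x _
    rw [← Finset.mul_sum, count_pi (insert i0 T) (fun i => Z i x y), mul_comm]
  have t2 : ∑ z : ι → Γ, ∑ y, ∑ v, (s.a v - ∑ x, s.A v x) * s.B v y * (if ∀ i ∈ T, f v i = z i then q ^ T.card else 0)
      = q ^ Fintype.card ι * ∑ v, (s.a v - ∑ x, s.A v x) * (∑ y, s.B v y) := by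
    rw [Finset.sum_comm, Finset.mul_sum]
    simp_rw [Finset.mul_sum]
    rw [Finset.sum_comm (s := (univ : Finset s.V))]
    apply Finset.sum_congr rfl
    intro y _
    rw [Finset.sum_comm]
    apply Finset.sum_congr rfl
    intro v _
    rw [← Finset.mul_sum, count_pi T (f v), mul_comm]
  rw [t1, t2]
  have hqq : 0 ≤ q ^ Fintype.card ι := by positivity
  nlinarith

lemma hybrid {ι Γ : Type} [Fintype ι] [LinearOrder ι] [Fintype Γ] [DecidableEq Γ] [Nonempty Γ]
    {pX : X → ℝ} {pY : Y → ℝ} (hX : ∑ x, pX x = 1) (hY : ∑ y, pY y = 1)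
    {δ : ℝ} (Z : ι → X → Y → Γ)
    (hs : ∀ i0, ∃ s : St X Y, s.Good pX pY δ ∧ (∀ i < i0, Kn s (Z i)) ∧ UnifX s (Z i0))
    (T : Finset ι) :
    ∑ z : ι → Γ, ∑ y, max ((Fintype.card Γ : ℝ) ^ T.card * jointP pX pY Z T z y - pY y) 0
    ≤ (Fintype.card Γ : ℝ) ^ Fintype.card ι * (T.card * (2 * δ)) := by
  induction T using Finset.induction_on_max with
  | empty =>
    simp only [jointP, Finset.card_empty, pow_zero, one_mul]
    apply le_of_eq
    simp only [Finset.notMem_empty, false_implies, implies_true, if_true, ← Finset.sum_mul, hX]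
    simp
  | insert i0 T hmax ih =>
    obtain ⟨s, hg, hk, hu⟩ := hs i0
    have hi0 : i0 ∉ T := fun h => lt_irrefl _ (hmax i0 h)
    have h1 := hybrid_step hX hY hg Z T i0 hi0 (fun i hi => hk i (hmax i hi)) hu
    have hci : (insert i0 T).card = T.card + 1 := Finset.card_insert_of_notMem hi0
    have h2 : ∀ z y, max ((Fintype.card Γ : ℝ) ^ (insert i0 T).card * jointP pX pY Z (insert i0 T) z y
        - pY y) 0 ≤ max ((Fintype.card Γ : ℝ) ^ (insert i0 T).card * jointP pX pY Z (insert i0 T) z y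
      - (Fintype.card Γ : ℝ) ^ T.card * jointP pX pY Z T z y) 0 +
      max ((Fintype.card Γ : ℝ) ^ T.card * jointP pX pY Z T z y - pY y) 0 := by
      intro z y
      apply max_le
      · refine le_trans (le_of_eq ?_) (add_le_add (le_max_left _ _) (le_max_left _ _))
        ring
      · exact add_nonneg (le_max_right _ _) (le_max_right _ _)
    refine (Finset.sum_le_sum fun z _ => Finset.sum_le_sum fun y _ => h2 z y).trans ?_
    simp only [Finset.sum_add_distrib]
    rw [hci] at h1 ⊢
    push_cast
    linarith

end Protocol

section Concrete

set_option linter.unusedSectionVars false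

/-- The data of the protocol restricted to a finite family of rows. -/
structure Prot (n rl ℓ M : ℕ) (ι Yt : Type) where
  Extq : BitStr M → BitStr ℓ → BitStr ℓ
  Extw : BitStr n → BitStr ℓ → BitStr ℓ
  Ext : BitStr rl → BitStr ℓ → BitStr M
  row : ι → Yt → BitStr rl
  ind : ι → ℕ → ℕ

variable {n rl ℓ M : ℕ} {ι Yt : Type}

def Prot.Y (P : Prot n rl ℓ M ι Yt) (i : ι) : ℕ → BitStr n → Yt → BitStr M
  | 0 => fun _ y => truncate M (P.row i y)
  | j + 1 => fun x y => P.Ext (P.row i y)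
      (laR P.Extq P.Extw x (P.Y i j x y) (truncate ℓ (P.Y i j x y)) (P.ind i j))

def Prot.S (P : Prot n rl ℓ M ι Yt) (i : ι) (j r : ℕ) (x : BitStr n) (y : Yt) : BitStr ℓ :=
  laS P.Extq P.Extw x (P.Y i j x y) (truncate ℓ (P.Y i j x y)) r

def Prot.R (P : Prot n rl ℓ M ι Yt) (i : ι) (j r : ℕ) (x : BitStr n) (y : Yt) : BitStr ℓ :=
  P.Extw x (P.S i j r x y)

variable [Fintype ι] [DecidableEq ι] [Fintype Yt]

lemma KnX.mapAux {X Y : Type} [Fintype X] [Fintype Y] {s : St X Y} {γ γ' : Type}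
    {F : X → Y → γ} (h : Kn s F) (g : X → γ → γ') :
    KnX s (fun x y => g x (F x y)) :=
  KnX.map₂ (knX_of s (fun x => x)) h.knX g

lemma knX_laR {Y : Type} [Fintype Y] {s : St (BitStr n) Y} {q : BitStr n → Y → BitStr M}
    (h : Kn s q) (Eq : BitStr M → BitStr ℓ → BitStr ℓ)
    (Ew : BitStr n → BitStr ℓ → BitStr ℓ) (r : ℕ) :
    KnX s (fun x y => laR Eq Ew x (q x y) (truncate ℓ (q x y)) r) :=
  KnX.mapAux h (fun x u => laR Eq Ew x u (truncate ℓ u) r)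

lemma ent_costX {X Y : Type} [Fintype X] [Fintype Y] {s s' : St X Y} {cX cY : ℝ}
    (h : Ref s s' cX cY) {γ : Type} [DecidableEq γ] {F : X → Y → γ} {e k : ℕ} (c : ℕ)
    (hc : cX = 2 ^ c) (he : EntX s F (2 ^ e / 2 ^ k)) : EntX s' F (2 ^ (e + c) / 2 ^ k) := by
  have := h.entX he
  rwa [hc, ← mul_div_assoc, ← pow_add, add_comm c e] at this

lemma ent_costY {X Y : Type} [Fintype X] [Fintype Y] {s s' : St X Y} {cX cY : ℝ}
    (h : Ref s s' cX cY) {γ : Type} [DecidableEq γ] {F : X → Y → γ} {e k : ℕ} (c : ℕ)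
    (hc : cY = 2 ^ c) (he : EntY s F (2 ^ e / 2 ^ k)) : EntY s' F (2 ^ (e + c) / 2 ^ k) := by
  have := h.entY he
  rwa [hc, ← mul_div_assoc, ← pow_add, add_comm c e] at this

lemma ent_freeX {X Y : Type} [Fintype X] [Fintype Y] {s s' : St X Y} {cY : ℝ}
    (h : Ref s s' 1 cY) {γ : Type} [DecidableEq γ] {F : X → Y → γ} {κ : ℝ}
    (he : EntX s F κ) : EntX s' F κ := by
  have := h.entX he
  rwa [one_mul] at this

lemma ent_freeY {X Y : Type} [Fintype X] [Fintype Y] {s s' : St X Y} {cX : ℝ}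
    (h : Ref s s' cX 1) {γ : Type} [DecidableEq γ] {F : X → Y → γ} {κ : ℝ}
    (he : EntY s F κ) : EntY s' F κ := by
  have := h.entY he
  rwa [one_mul] at this

lemma pow_ok {K e k : ℕ} (h : K + e ≤ k) : (2 : ℝ) ^ K * (2 ^ e / 2 ^ k) ≤ 1 := by
  rw [← mul_div_assoc, ← pow_add]
  apply div_le_one_of_le₀ _ (by positivity)
  exact pow_le_pow_right₀ (by norm_num) h

lemma pow_div_mono {e e' k : ℕ} (h : e ≤ e') : (2 : ℝ) ^ e / 2 ^ k ≤ 2 ^ e' / 2 ^ k := by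
  gcongr
  norm_num

lemma card_tuple (m : ℕ) : ((Fintype.card (ι → BitStr m) : ℕ) : ℝ) = 2 ^ (m * Fintype.card ι) := by
  simp [pow_mul]

/-- The state before round `r` of block `j`. -/
structure Rnd (P : Prot n rl ℓ M ι Yt) (D : ι → ℕ → Prop) (i0 : ι) (k : ℕ)
    (pX : BitStr n → ℝ) (pY : Yt → ℝ) (s : St (BitStr n) Yt) (j r : ℕ) (δ : ℝ)
    (eX eY eQ : ℕ) : Prop where
  good : s.Good pX pY δ
  yv : ∀ i, KnY s (P.Y i j)
  sv : ∀ i, KnY s (P.S i j r)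
  kr : ∀ i, (D i j ∨ (D i (j + 1) ∧ P.ind i j < r)) → Kn s (P.R i j (P.ind i j))
  us : UnifY s (P.S i0 j r)
  ex : EntX s (fun x _ => x) (2 ^ eX / 2 ^ k)
  ey : EntY s (fun _ y => P.row i0 y) (2 ^ eY / 2 ^ rl)
  eq : EntY s (P.Y i0 j) (2 ^ eQ / 2 ^ M)

variable {P : Prot n rl ℓ M ι Yt} {D : ι → ℕ → Prop} {i0 : ι} {k : ℕ}
  {pX : BitStr n → ℝ} {pY : Yt → ℝ} {ε : ℝ}

lemma Rnd.step {s : St (BitStr n) Yt} {j r : ℕ} {δ : ℝ} {eX eY eQ : ℕ}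
    (h : Rnd P D i0 k pX pY s j r δ eX eY eQ)
    (hq : IsStrongSeededExtractor P.Extq (10 * ℓ : ℕ) ε)
    (hw : IsStrongSeededExtractor P.Extw (10 * ℓ : ℕ) ε)
    (hn : 10 * ℓ + 1 ≤ n) (hM : 10 * ℓ + 1 ≤ M)
    (hX : 10 * ℓ + eX ≤ k) (hQ : 10 * ℓ + (eQ + ℓ + ℓ * Fintype.card ι) ≤ M) :
    ∃ s', Rnd P D i0 k pX pY s' j (r + 1) (δ + 6 * ε) (eX + ℓ + ℓ * Fintype.card ι)
      (eY + ℓ + ℓ * Fintype.card ι) (eQ + ℓ + ℓ * Fintype.card ι) := by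
  obtain ⟨s1, g1, k1, f1, u1⟩ := extractX hw hn h.good h.us h.ex (pow_ok hX)
  obtain ⟨s2, g2, k2, f2, u2'⟩ := revealY g1 (KnY.pi (fun i => f1.knY (h.sv i)))
  have u2 := u2' u1
  have eq2 := ent_costY f2 _ (card_tuple ℓ) (ent_costY f1 ℓ rfl h.eq)
  have ey2 := ent_costY f2 _ (card_tuple ℓ) (ent_costY f1 ℓ rfl h.ey)
  obtain ⟨s3, g3, k3, f3, u3⟩ := extractY hq hM g2 u2 eq2 (pow_ok hQ)
  have kx : ∀ i, KnX s2 (P.R i j r) := fun i =>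
    KnX.mapAux (k2.map (fun t => t i)) P.Extw
  obtain ⟨s4, g4, k4, f4, u4'⟩ := revealX g3 (KnX.pi (fun i => f3.knX (kx i)))
  have kr4 : ∀ i, Kn s4 (P.R i j r) := fun i => k4.map (fun t => t i)
  have yv4 : ∀ i, KnY s4 (P.Y i j) := fun i => f4.knY (f3.knY (f2.knY (f1.knY (h.yv i))))
  refine ⟨s4, ⟨g4.mono (by linarith), yv4, fun i => ?_, fun i hi => ?_, u4' u3, ?_, ?_, ?_⟩⟩
  · exact KnY.map₂ (yv4 i) (kr4 i).knY P.Extq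
  · by_cases hc : P.ind i j = r
    · rw [hc]; exact kr4 i
    · refine f4.kn (f3.kn (f2.kn (f1.kn (h.kr i ?_))))
      rcases hi with hi | ⟨hi, hi'⟩
      · exact Or.inl hi
      · exact Or.inr ⟨hi, by omega⟩
  · exact ent_costX f4 _ (card_tuple ℓ) (ent_costX f3 ℓ rfl (ent_freeX f2 (ent_freeX f1 h.ex)))
  · exact ent_freeY f4 (ent_freeY f3 ey2)
  · exact ent_freeY f4 (ent_freeY f3 eq2)

lemma Rnd.steps {s : St (BitStr n) Yt} {j : ℕ} {δ : ℝ} {eX eY : ℕ}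
    (h : Rnd P D i0 k pX pY s j 0 δ eX eY 0)
    (hq : IsStrongSeededExtractor P.Extq (10 * ℓ : ℕ) ε)
    (hw : IsStrongSeededExtractor P.Extw (10 * ℓ : ℕ) ε)
    (hn : 10 * ℓ + 1 ≤ n) (hM : 10 * ℓ + 1 ≤ M) (t : ℕ)
    (hX : 10 * ℓ + (eX + t * (ℓ + ℓ * Fintype.card ι)) ≤ k)
    (hQ : 10 * ℓ + t * (ℓ + ℓ * Fintype.card ι) ≤ M) :
    ∃ s', Rnd P D i0 k pX pY s' j t (δ + 6 * t * ε) (eX + t * (ℓ + ℓ * Fintype.card ι))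
      (eY + t * (ℓ + ℓ * Fintype.card ι)) (t * (ℓ + ℓ * Fintype.card ι)) := by
  induction t with
  | zero => exact ⟨s, by simpa using h⟩
  | succ t ih =>
    rw [add_mul, one_mul] at hX hQ
    obtain ⟨s', hs'⟩ := ih (by omega) (by omega)
    obtain ⟨s'', hs''⟩ := hs'.step hq hw hn hM (by omega) (by omega)
    refine ⟨s'', ?_⟩
    convert hs'' using 1
    · push_cast; ring
    · ring
    · ring
    · ring

/-- The state at the end of block `j`. -/
structure Fino (P : Prot n rl ℓ M ι Yt) (D : ι → ℕ → Prop) (i0 : ι) (k : ℕ)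
    (pX : BitStr n → ℝ) (pY : Yt → ℝ) (s : St (BitStr n) Yt) (j : ℕ) (δ : ℝ)
    (eX eY : ℕ) : Prop where
  good : s.Good pX pY δ
  yv : ∀ i, KnY s (P.Y i j)
  kr : ∀ i, D i (j + 1) → Kn s (P.R i j (P.ind i j))
  ur : UnifX s (P.R i0 j (P.ind i0 j))
  ex : EntX s (fun x _ => x) (2 ^ eX / 2 ^ k)
  ey : EntY s (fun _ y => P.row i0 y) (2 ^ eY / 2 ^ rl)

lemma Rnd.fino {s : St (BitStr n) Yt} {j : ℕ} {δ : ℝ} {eX eY eQ : ℕ}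
    (h : Rnd P D i0 k pX pY s j (P.ind i0 j) δ eX eY eQ)
    (hw : IsStrongSeededExtractor P.Extw (10 * ℓ : ℕ) ε)
    (hn : 10 * ℓ + 1 ≤ n) (hX : 10 * ℓ + eX ≤ k)
    (hD : ∀ i, ¬ D i j → D i (j + 1) → P.ind i j < P.ind i0 j) :
    ∃ s', Fino P D i0 k pX pY s' j (δ + 3 * ε) eX (eY + ℓ) := by
  obtain ⟨s1, g1, k1, f1, u1⟩ := extractX hw hn h.good h.us h.ex (pow_ok hX)
  refine ⟨s1, g1, fun i => f1.knY (h.yv i), fun i hi => f1.kn (h.kr i ?_), u1,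
    ent_freeX f1 h.ex, ent_costY f1 ℓ rfl h.ey⟩
  by_cases hc : D i j
  · exact Or.inl hc
  · exact Or.inr ⟨hi, hD i hc hi⟩

lemma trunc_fiber {r m : ℕ} (hmr : m ≤ r) (z : BitStr m) :
    ((univ.filter fun w : BitStr r => truncate m w = z).card : ℝ) *
      (Fintype.card (BitStr r) : ℝ)⁻¹ ≤ (Fintype.card (BitStr m) : ℝ)⁻¹ := by
  have h1 : (univ.filter fun w : BitStr r => truncate m w = z).card ≤ 2 ^ (r - m) := by
    have : Fintype.card (BitStr (r - m)) = 2 ^ (r - m) := by simp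
    rw [← this, ← Finset.card_univ]
    apply Finset.card_le_card_of_injOn (fun (w : BitStr r) (t : Fin (r - m)) => w ⟨m + t, by omega⟩)
      (fun _ _ => Finset.mem_coe.mpr (Finset.mem_univ _))
    intro w hw w' hw' he
    simp only [Finset.coe_filter, Finset.mem_univ, true_and, Set.mem_ofPred_eq] at hw hw'
    funext t
    by_cases ht : (t : ℕ) < m
    · have := congrFun (hw.trans hw'.symm) ⟨t, ht⟩
      simpa [truncate] using this
    · have := congrFun he ⟨t - m, by omega⟩
      have e : (⟨m + ((t : ℕ) - m), by omega⟩ : Fin r) = t := Fin.ext (by simp; omega)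
      simpa [e] using this
  have h2 : ((univ.filter fun w : BitStr r => truncate m w = z).card : ℝ) ≤ 2 ^ (r - m) := by
    exact_mod_cast h1
  have c1 : (Fintype.card (BitStr r) : ℝ) = 2 ^ r := by simp
  have c2 : (Fintype.card (BitStr m) : ℝ) = 2 ^ m := by simp
  rw [c1, c2]
  have h3 : (2 : ℝ) ^ r = 2 ^ (r - m) * 2 ^ m := by rw [← pow_add, Nat.sub_add_cancel hmr]
  rw [h3, mul_inv]
  calc _ ≤ (2 : ℝ) ^ (r - m) * ((2 ^ (r - m))⁻¹ * (2 ^ m)⁻¹) := by gcongr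
    _ = _ := by field_simp
    _ ≤ _ := le_rfl

lemma rnd_start {s : St (BitStr n) Yt} {j : ℕ} {δ : ℝ} {eX eY : ℕ} (hM : ℓ ≤ M)
    (good : s.Good pX pY δ) (yv : ∀ i, KnY s (P.Y i j))
    (kr : ∀ i, D i j → Kn s (P.R i j (P.ind i j)))
    (uy : UnifY s (P.Y i0 j))
    (ex : EntX s (fun x _ => x) (2 ^ eX / 2 ^ k))
    (ey : EntY s (fun _ y => P.row i0 y) (2 ^ eY / 2 ^ rl)) :
    Rnd P D i0 k pX pY s j 0 δ eX eY 0 where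
  good := good
  yv := yv
  sv := fun i => (yv i).map (truncate ℓ)
  kr := fun i hi => kr i (by
    rcases hi with hi | ⟨_, hi⟩
    · exact hi
    · exact absurd hi (Nat.not_lt_zero _))
  us := UnifY.map good uy (truncate ℓ) (trunc_fiber hM)
  ex := ex
  ey := ey
  eq := (uy.entY good).mono (by simp)

open Classical in
lemma Fino.next {s : St (BitStr n) Yt} {j : ℕ} {δ : ℝ} {eX eY : ℕ}
    (h : Fino P D i0 k pX pY s j δ eX eY)
    (he : IsStrongSeededExtractor P.Ext (2 * M : ℕ) ε)
    (hM : ℓ ≤ M) (hrl : 2 * M + 1 ≤ rl)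
    (hY : 2 * M + (eY + M * Fintype.card ι) ≤ rl) :
    ∃ s', Rnd P D i0 k pX pY s' (j + 1) 0 (δ + 3 * ε)
      (eX + ℓ + ℓ * Fintype.card ι + ℓ * Fintype.card ι) (eY + M * Fintype.card ι) 0 := by
  have ky : ∀ i, KnY s (fun x y => if D i (j + 1) then P.Y i (j + 1) x y else P.Y i j x y) := by
    intro i
    by_cases hD : D i (j + 1)
    · simp only [if_pos hD]
      exact KnY.map₂ (knY_of s (P.row i)) (h.kr i hD).knY P.Ext
    · simp only [if_neg hD]
      exact h.yv i
  obtain ⟨s1, g1, k1, f1, u1'⟩ := revealY h.good (KnY.pi ky)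
  have u1 := u1' h.ur
  have ey1 := ent_costY f1 _ (card_tuple M) h.ey
  obtain ⟨s2, g2, k2, f2, u2⟩ := extractY he hrl g1 u1 ey1 (pow_ok hY)
  have kr2 : ∀ i, KnX s2 (P.R i j (P.ind i j)) := by
    intro i
    by_cases hD : D i (j + 1)
    · exact (f2.kn (f1.kn (h.kr i hD))).knX
    · have := k1.map (fun t => t i)
      simp only [if_neg hD] at this
      exact f2.knX (knX_laR this P.Extq P.Extw (P.ind i j))
  obtain ⟨s3, g3, k3, f3, u3'⟩ := revealX g2 (KnX.pi kr2)
  have kr3 : ∀ i, KnX s3 (fun x y => if D i (j + 1) then P.R i (j + 1) (P.ind i (j + 1)) x y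
      else fun _ => false) := by
    intro i
    by_cases hD : D i (j + 1)
    · have := k1.map (fun t => t i)
      simp only [if_pos hD] at this ⊢
      exact f3.knX (f2.knX (knX_laR this P.Extq P.Extw (P.ind i (j + 1))))
    · simp only [if_neg hD]
      exact (kn_const _ _).knX
  obtain ⟨s4, g4, k4, f4, u4'⟩ := revealX g3 (KnX.pi kr3)
  refine ⟨s4, rnd_start hM g4 (fun i => f4.knY ?_) (fun i hi => ?_) (u4' (u3' u2)) ?_ ?_⟩
  · exact KnY.map₂ (knY_of s3 (P.row i)) (k3.map (fun t => t i)).knY P.Ext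
  · have := k4.map (fun t => t i)
    simpa only [if_pos hi] using this
  · exact ent_costX f4 _ (card_tuple ℓ) (ent_costX f3 _ (card_tuple ℓ)
      (ent_costX f2 ℓ rfl (ent_freeX f1 h.ex)))
  · exact ent_freeY f4 (ent_freeY f3 (ent_freeY f2 ey1))

lemma Rnd.mono {s : St (BitStr n) Yt} {j r : ℕ} {δ δ' : ℝ} {eX eY eQ eX' eY' : ℕ}
    (h : Rnd P D i0 k pX pY s j r δ eX eY eQ) (hδ : δ ≤ δ') (hX : eX ≤ eX') (hY : eY ≤ eY') :
    Rnd P D i0 k pX pY s j r δ' eX' eY' eQ :=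
  { h with
    good := h.good.mono hδ
    ex := EntY.mono (s := s.swap) h.ex (pow_div_mono hX)
    ey := h.ey.mono (pow_div_mono hY) }

lemma round_budget {t h ℓ : ℕ} (ht : t < h) : t * (ℓ + ℓ * h) + ℓ ≤ h ^ 2 * ℓ := by
  obtain ⟨u, rfl⟩ := Nat.exists_eq_add_of_lt ht
  nlinarith [Nat.zero_le (u * u * ℓ), Nat.zero_le (t * u * ℓ), Nat.zero_le (u * ℓ),
    Nat.zero_le (t * ℓ)]

/-- From the start of a block to its end. -/
lemma Rnd.toFino {s : St (BitStr n) Yt} {j h : ℕ} {δ : ℝ} {eX eY : ℕ}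
    (hs : Rnd P D i0 k pX pY s j 0 δ eX eY 0)
    (hq : IsStrongSeededExtractor P.Extq (10 * ℓ : ℕ) ε)
    (hw : IsStrongSeededExtractor P.Extw (10 * ℓ : ℕ) ε)
    (hD : ∀ i, ¬ D i j → D i (j + 1) → P.ind i j < P.ind i0 j)
    (hι : Fintype.card ι = h) (hM : M = (h ^ 2 + 12) * ℓ) (hℓ : 0 < ℓ)
    (hn : 10 * ℓ + 1 ≤ n) (hX : eX + M ≤ k) (hind : P.ind i0 j < h) :
    ∃ s', ∃ eX' eY', Fino P D i0 k pX pY s' j (δ + 6 * P.ind i0 j * ε + 3 * ε) eX' eY' ∧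
      eX' + ℓ ≤ eX + M ∧ eY' ≤ eY + M := by
  have hb := round_budget (ℓ := ℓ) hind
  rw [add_mul] at hM
  subst hι
  obtain ⟨s1, h1⟩ := hs.steps hq hw hn (by omega) (P.ind i0 j) (by omega) (by omega)
  obtain ⟨s2, h2⟩ := h1.fino hw hn (by omega) hD
  exact ⟨s2, _, _, h2, by omega, by omega⟩

lemma blocks {b h : ℕ}
    (h0 : ∃ s, Rnd P D i0 k pX pY s 0 0 0 0 0 0)
    (hq : IsStrongSeededExtractor P.Extq (10 * ℓ : ℕ) ε)
    (hw : IsStrongSeededExtractor P.Extw (10 * ℓ : ℕ) ε)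
    (he : IsStrongSeededExtractor P.Ext (2 * M : ℕ) ε)
    (hD : ∀ i j, j < b → ¬ D i j → D i (j + 1) → P.ind i j < P.ind i0 j)
    (hι : Fintype.card ι = h) (hM : M = (h ^ 2 + 12) * ℓ) (hℓ : 0 < ℓ) (hε : 0 ≤ ε)
    (hn : 10 * ℓ + 1 ≤ n) (hk : b * (2 * M) ≤ k)
    (hrl : ∀ j, j + 1 < b → (j + 1) * ((h + 1) * M) + 2 * M + 1 ≤ rl)
    (hind : ∀ j, P.ind i0 j < h) (j : ℕ) (hj : j < b) :
    ∃ s, Rnd P D i0 k pX pY s j 0 (6 * h * j * ε) (j * (2 * M)) (j * ((h + 1) * M)) 0 := by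
  have hMl : 12 * ℓ ≤ M := by rw [hM]; nlinarith [Nat.zero_le (h ^ 2 * ℓ)]
  have hMl2 : 2 * (ℓ * h) ≤ M := by
    rw [hM]
    have : 2 * h ≤ h ^ 2 + 12 := by nlinarith [sq_nonneg ((h : ℤ) - 1), Nat.zero_le h, mul_self_nonneg ((h:ℤ) - 1)]
    calc 2 * (ℓ * h) = 2 * h * ℓ := by ring
      _ ≤ _ := Nat.mul_le_mul_right _ this
  induction j with
  | zero => simpa using h0
  | succ j ih =>
    obtain ⟨s, hs⟩ := ih (by omega)
    have hkj : (j + 2) * (2 * M) ≤ b * (2 * M) := Nat.mul_le_mul_right _ (by omega)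
    have hr := hrl j hj
    rw [add_mul] at hkj
    rw [add_mul (j : ℕ) 1, one_mul] at hr
    have e1 : (h + 1) * M = M * h + M := by ring
    obtain ⟨s1, eX', eY', h1, b1, b2⟩ := hs.toFino hq hw (fun i => hD i j (by omega)) hι hM hℓ hn
      (by omega) (hind j)
    obtain ⟨s2, h2⟩ := h1.next he (by omega) (by omega) (by rw [hι]; omega)
    refine ⟨s2, h2.mono ?_ ?_ ?_⟩
    · have : ((P.ind i0 j : ℕ) : ℝ) + 1 ≤ h := by exact_mod_cast hind j
      push_cast
      nlinarith
    · rw [hι, add_mul]; omega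
    · rw [hι, add_mul]; omega

lemma blocks_end {b h : ℕ} (hb : 0 < b)
    (h0 : ∃ s, Rnd P D i0 k pX pY s 0 0 0 0 0 0)
    (hq : IsStrongSeededExtractor P.Extq (10 * ℓ : ℕ) ε)
    (hw : IsStrongSeededExtractor P.Extw (10 * ℓ : ℕ) ε)
    (he : IsStrongSeededExtractor P.Ext (2 * M : ℕ) ε)
    (hD : ∀ i j, j < b → ¬ D i j → D i (j + 1) → P.ind i j < P.ind i0 j)
    (hι : Fintype.card ι = h) (hM : M = (h ^ 2 + 12) * ℓ) (hℓ : 0 < ℓ) (hε : 0 ≤ ε)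
    (hn : 10 * ℓ + 1 ≤ n) (hk : b * (2 * M) ≤ k)
    (hrl : ∀ j, j + 1 < b → (j + 1) * ((h + 1) * M) + 2 * M + 1 ≤ rl)
    (hind : ∀ j, P.ind i0 j < h) :
    ∃ s : St (BitStr n) Yt, s.Good pX pY (6 * h * b * ε) ∧
      (∀ i, D i b → Kn s (P.R i (b - 1) (P.ind i (b - 1)))) ∧
      UnifX s (P.R i0 (b - 1) (P.ind i0 (b - 1))) := by
  obtain ⟨c, rfl⟩ : ∃ c, b = c + 1 := ⟨b - 1, by omega⟩
  obtain ⟨s, hs⟩ := blocks h0 hq hw he hD hι hM hℓ hε hn hk hrl hind c (by omega)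
  rw [add_mul] at hk
  obtain ⟨s1, eX', eY', h1, -, -⟩ := hs.toFino hq hw (fun i => hD i c (by omega)) hι hM hℓ hn
      (by omega) (hind c)
  refine ⟨s1, h1.good.mono ?_, h1.kr, h1.ur⟩
  have : ((P.ind i0 c : ℕ) : ℝ) + 1 ≤ h := by exact_mod_cast hind c
  push_cast
  nlinarith

/-- The initial state. -/
lemma init_state {pX : BitStr n → ℝ} {pY : Yt → ℝ} (hX : IsProb pX) (hY : IsProb pY)
    (hk : IsKSource pX (k : ℝ)) (hD : ∀ i, ¬ D i 0) (hM : ℓ ≤ M) (hrl : M ≤ rl)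
    (hu : ∀ v, (∑ y, if P.row i0 y = v then pY y else 0) = unif (BitStr rl) v) :
    ∃ s, Rnd P D i0 k pX pY s 0 0 0 0 0 0 := by
  let s : St (BitStr n) Yt := ⟨Unit, inferInstance, fun _ => pX, fun _ => pY, fun _ => 1, fun _ => 1⟩
  have hg : s.Good pX pY 0 :=
    { A_nn := fun _ => hX.1
      B_nn := fun _ => hY.1
      hA := fun _ => hX.2.le
      hB := fun _ => hY.2.le
      dom := fun x y => by simp [s]
      nom := by simp [s]
      mass := by simp [s, hX.2, hY.2] }
  have hur : UnifY s (fun _ y => P.row i0 y) :=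
    ⟨fun _ y => P.row i0 y, fun _ _ _ _ _ => rfl, fun v z => by
      have := hu z
      simp only [unif] at this
      simpa [s] using this.le⟩
  refine ⟨s, rnd_start hM hg (fun i => knY_of s (fun y => truncate M (P.row i y)))
    (fun i hi => absurd hi (hD i)) (UnifY.map hg hur (truncate M) (trunc_fiber hrl)) ?_ ?_⟩
  · refine ⟨fun _ x => x, fun _ => (2 ^ k)⁻¹, fun _ _ _ _ _ => rfl, fun _ => by positivity, ?_, ?_⟩
    · intro v z
      have := hk z
      rw [Real.rpow_neg (by norm_num), Real.rpow_natCast] at this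
      simpa [s, St.swap] using this
    · show ∑ _v : Unit, (1 : ℝ) * (2 ^ k)⁻¹ ≤ _
      simp
  · exact (hur.entY hg).mono (by simp)

end Concrete

lemma blockVal_facts {d l b : ℕ} (hd : d ≤ b * l) (u v : ℕ) :
    let pr : ℕ → ℕ → ℕ := fun v j => v * 2 ^ (b * l - d) / 2 ^ ((b - j) * l)
    (v < 2 ^ d → pr v 0 = 0) ∧ (u < v → pr u b < pr v b) ∧
    (∀ j, j < b → ¬ pr u j < pr v j → pr u (j + 1) < pr v (j + 1) →
      blockVal d l b u j < blockVal d l b v j) := by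
  intro pr
  refine ⟨fun hv => ?_, fun h => ?_, fun j hj h1 h2 => ?_⟩
  · apply Nat.div_eq_of_lt
    calc v * 2 ^ (b * l - d) < 2 ^ d * 2 ^ (b * l - d) :=
          Nat.mul_lt_mul_of_pos_right hv (by positivity)
      _ = 2 ^ ((b - 0) * l) := by rw [← pow_add]; congr 1; simp; omega
  · simp only [pr, Nat.sub_self, zero_mul, pow_zero, Nat.div_one]
    exact Nat.mul_lt_mul_of_pos_right h (by positivity)
  · have key : ∀ w, pr w (j + 1) = 2 ^ l * pr w j + blockVal d l b w j := by
      intro w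
      have e : (b - j) * l = (b - 1 - j) * l + l := by
        obtain ⟨c, rfl⟩ : ∃ c, b = j + 1 + c := ⟨b - (j + 1), by omega⟩
        have e1 : j + 1 + c - j = c + 1 := by omega
        have e2 : j + 1 + c - 1 - j = c := by omega
        rw [e1, e2]; ring
      have e' : b - (j + 1) = b - 1 - j := by omega
      simp only [pr, blockVal]
      rw [e, e', pow_add, ← Nat.div_div_eq_div_mul]
      exact (Nat.div_add_mod _ _).symm
    rw [key u, key v] at h2
    have h3 : pr v j ≤ pr u j := Nat.le_of_not_lt h1
    have h4 : 2 ^ l * pr v j ≤ 2 ^ l * pr u j := Nat.mul_le_mul_left _ h3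
    omega

lemma final_convert {X Y ι Γ : Type} [Fintype X] [Fintype Y] [Fintype ι] [LinearOrder ι]
    [Fintype Γ] [DecidableEq Γ] [Nonempty Γ] {pX : X → ℝ} {pY : Y → ℝ} (hX : IsProb pX)
    (hY : IsProb pY) {δ : ℝ} (Z : ι → X → Y → Γ)
    (hs : ∀ i0, ∃ s : St X Y, s.Good pX pY δ ∧ (∀ i < i0, Kn s (Z i)) ∧ UnifX s (Z i0)) :
    statDist (fun w : (ι → Γ) × Y => ∑ x : X, if ∀ i, Z i x w.2 = w.1 i then pX x * pY w.2 else 0)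
      (fun w => unif (ι → Γ) w.1 * pY w.2) ≤ Fintype.card ι * (2 * δ) := by
  have h1 := hybrid hX.2 hY.2 Z hs univ
  have hq : (0 : ℝ) < (Fintype.card Γ : ℝ) ^ Fintype.card ι := by
    have : (0 : ℝ) < (Fintype.card Γ : ℝ) := by exact_mod_cast Fintype.card_pos
    positivity
  have hun : ∀ z, unif (ι → Γ) z = ((Fintype.card Γ : ℝ) ^ Fintype.card ι)⁻¹ := by
    intro z; simp [unif]
  apply statDist_le_of_sum_pos
  · rw [Fintype.sum_prod_type, Fintype.sum_prod_type]
    have e1 : ∑ z : ι → Γ, ∑ y, unif (ι → Γ) z * pY y = 1 := by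
      simp_rw [← Finset.mul_sum, hY.2, mul_one]
      exact sum_unif _
    rw [e1, Finset.sum_comm]
    have e2 : ∀ y, ∑ z : ι → Γ, ∑ x : X, (if ∀ i, Z i x y = z i then pX x * pY y else 0) = pY y := by
      intro y
      rw [Finset.sum_comm]
      have : ∀ x, ∑ z : ι → Γ, (if ∀ i, Z i x y = z i then pX x * pY y else 0) = pX x * pY y := by
        intro x
        simp_rw [← funext_iff]
        simp
      simp_rw [this, ← Finset.sum_mul, hX.2, one_mul]
    simp only [e2, hY.2]
  · rw [Fintype.sum_prod_type]
    have e3 : ∀ z y, max ((∑ x : X, if ∀ i, Z i x y = z i then pX x * pY y else 0)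
        - unif (ι → Γ) z * pY y) 0 = ((Fintype.card Γ : ℝ) ^ Fintype.card ι)⁻¹ *
        max ((Fintype.card Γ : ℝ) ^ (univ : Finset ι).card * jointP pX pY Z univ z y - pY y) 0 := by
      intro z y
      rw [mul_max_of_nonneg _ _ (inv_nonneg.mpr hq.le), mul_zero, hun]
      congr 1
      rw [Finset.card_univ, mul_sub, ← mul_assoc, inv_mul_cancel₀ hq.ne', one_mul]
      simp [jointP]
    simp only [e3, ← Finset.mul_sum]
    rw [inv_mul_le_iff₀ hq]
    exact h1

lemma k_le_n {n k : ℕ} {pX : BitStr n → ℝ} (hX : IsProb pX) (hk : IsKSource pX (k : ℝ)) : k ≤ n := by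
  have h1 : (1 : ℝ) ≤ 2 ^ n * (2 ^ k)⁻¹ := by
    rw [← hX.2]
    refine (Finset.sum_le_sum fun x _ => hk x).trans (le_of_eq ?_)
    rw [Real.rpow_neg (by norm_num), Real.rpow_natCast]
    simp
  by_contra hc
  push Not at hc
  have h2 : (2 : ℝ) ^ n < 2 ^ k := pow_lt_pow_right₀ (by norm_num) hc
  have h3 : (0 : ℝ) < 2 ^ k := by positivity
  rw [← div_eq_mul_inv, le_div_iff₀ h3] at h1
  linarith

lemma SSR_eq {n rl ℓ M N : ℕ} {ι : Type} (d l b : ℕ)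
    (P : Prot n rl ℓ M ι (Fin N → BitStr rl)) (f : ι → Fin N)
    (hrow : ∀ i y, P.row i y = y (f i)) (hind : ∀ i j, P.ind i j = blockVal d l b (f i : ℕ) j)
    (x : BitStr n) (y : Fin N → BitStr rl) (i : ι) :
    SSR d l b P.Extq P.Extw P.Ext x y (f i) = P.R i (b - 1) (P.ind i (b - 1)) x y := by
  have key : ∀ j, (Nat.rec (truncate M (y (f i)))
        (fun j' prev =>
          P.Ext (y (f i)) (laR P.Extq P.Extw x prev (truncate ℓ prev) (blockVal d l b (f i : ℕ) j')))
        j : BitStr M) = P.Y i j x y := by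
    intro j
    induction j with
    | zero =>
      simp only [Prot.Y, hrow]
      rfl
    | succ j ih => simp only [Prot.Y, hrow, ih, hind]
  unfold SSR Prot.R Prot.S
  simp only [key, hind]
  rfl

theorem ssr_h_wise_independent :
    ∃ c : ℝ, 0 < c ∧
      ∀ (n k ℓ l h b d N : ℕ) (α β ε₂ : ℝ),
        0 < α → α < β → β < 1 →
        ℓ = ⌈(k : ℝ) ^ β⌉₊ →
        0 < l → h = 2 ^ l →
        (k : ℝ) ^ α ≤ (h : ℝ) → (h : ℝ) < 2 * (k : ℝ) ^ α →
        N = 2 ^ d → b = ⌈(d : ℝ) / (l : ℝ)⌉₊ →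
        2 * (b * h + 2) * (h ^ 2 + 12) * ℓ ≤ k →
        ∀ (Extq : BitStr ((h ^ 2 + 12) * ℓ) → BitStr ℓ → BitStr ℓ)
          (Extw : BitStr n → BitStr ℓ → BitStr ℓ)
          (Ext : BitStr (9 * k / 10) → BitStr ℓ → BitStr ((h ^ 2 + 12) * ℓ)),
          IsStrongSeededExtractor Extq (10 * ℓ : ℕ) ε₂ →
          IsStrongSeededExtractor Extw (10 * ℓ : ℕ) ε₂ →
          IsStrongSeededExtractor Ext (2 * ((h ^ 2 + 12) * ℓ) : ℕ) ε₂ →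
          ∀ (pX : BitStr n → ℝ) (pY : (Fin N → BitStr (9 * k / 10)) → ℝ)
            (S : Finset (Fin N)),
            IsProb pX → IsProb pY → IsKSource pX (k : ℝ) →
            (∀ i ∈ S, ∀ v, (∑ y, if y i = v then pY y else 0) =
              unif (BitStr (9 * k / 10)) v) →
            ∀ S' ⊆ S, S'.card = h →
              statDist
                (fun w : (↥S' → BitStr ℓ) × (Fin N → BitStr (9 * k / 10)) =>
                  ∑ x : BitStr n,
                    if ∀ i : ↥S', SSR d l b Extq Extw Ext x w.2 i.1 = w.1 i
                    then pX x * pY w.2 else 0)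
                (fun w => unif (↥S' → BitStr ℓ) w.1 * pY w.2)
              ≤ c * b * h ^ 2 * ε₂ := by
  refine ⟨12, by norm_num, ?_⟩
  intro n k ℓ l h b d N α β ε₂ hα hαβ hβ hℓ hl hh hkα hkα' hN hb hk Extq Extw Ext hq hw he
    pX pY S hX hY hkX hS S' hS' hcard
  have hkn := k_le_n hX hkX
  have hk0 : 0 < k := by
    rcases Nat.eq_zero_or_pos k with h0 | h0
    · rw [h0, Nat.cast_zero, Real.zero_rpow hα.ne'] at hkα'
      have : (0 : ℝ) ≤ (h : ℝ) := Nat.cast_nonneg _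
      linarith
    · exact h0
  have hℓ0 : 0 < ℓ := by
    rw [hℓ, Nat.ceil_pos]
    exact Real.rpow_pos_of_pos (by exact_mod_cast hk0) _
  have hh2 : 2 ≤ h := by
    rw [hh]
    calc 2 = 2 ^ 1 := by norm_num
      _ ≤ 2 ^ l := Nat.pow_le_pow_right (by norm_num) hl
  have hdl : d ≤ b * l := by
    have h1 : (d : ℝ) / l ≤ b := by rw [hb]; exact Nat.le_ceil _
    have h2 : (0 : ℝ) < l := by exact_mod_cast hl
    rw [div_le_iff₀ h2] at h1
    exact_mod_cast h1
  have hb0 : 0 < b := by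
    rcases Nat.eq_zero_or_pos b with h0 | h0
    · exfalso
      have hd0 : d = 0 := by rw [h0, zero_mul] at hdl; omega
      have h3 := Finset.card_le_univ S'
      rw [Fintype.card_fin, hcard] at h3
      rw [hd0, pow_zero] at hN
      omega
    · exact h0
  obtain ⟨M, hM⟩ : ∃ M, M = (h ^ 2 + 12) * ℓ := ⟨_, rfl⟩
  have hMl : 12 * ℓ ≤ M := by rw [hM]; nlinarith [Nat.zero_le (h ^ 2 * ℓ)]
  have hk' : 2 * (b * h + 2) * M ≤ k := by rw [hM, ← mul_assoc]; exact hk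
  have hbM : 2 * (b * M) ≤ b * h * M := by
    calc 2 * (b * M) = b * 2 * M := by ring
      _ ≤ b * h * M := by gcongr
  have hkk : 2 * (b * h * M) + 4 * M ≤ k := by
    refine le_trans (le_of_eq ?_) hk'; ring
  have hhM : 2 * M ≤ h * M := Nat.mul_le_mul_right _ hh2
  have hrl0 : 2 * M + 1 ≤ 9 * k / 10 := by
    rw [Nat.le_div_iff_mul_le (by norm_num)]
    omega
  have hrl : ∀ j, j + 1 < b → (j + 1) * ((h + 1) * M) + 2 * M + 1 ≤ 9 * k / 10 := by
    intro j hj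
    rw [Nat.le_div_iff_mul_le (by norm_num)]
    have e1 : (j + 1) * ((h + 1) * M) ≤ b * ((h + 1) * M) := Nat.mul_le_mul_right _ (by omega)
    have e2 : b * ((h + 1) * M) = b * h * M + b * M := by ring
    omega
  subst hM
  have hε : 0 ≤ ε₂ := eps_nonneg Extw hw (by omega)
  let P : Prot n (9 * k / 10) ℓ ((h ^ 2 + 12) * ℓ) ↥S' (Fin N → BitStr (9 * k / 10)) :=
    ⟨Extq, Extw, Ext, fun i y => y i.1, fun i j => blockVal d l b (i.1 : ℕ) j⟩
  have hιc : Fintype.card ↥S' = h := by rw [Fintype.card_coe, hcard]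
  have main := final_convert hX hY (δ := 6 * h * b * ε₂)
    (fun (i : ↥S') x y => SSR d l b Extq Extw Ext x y i.1) (by
      intro i0
      let D : ↥S' → ℕ → Prop := fun i j =>
        ((i.1 : Fin N) : ℕ) * 2 ^ (b * l - d) / 2 ^ ((b - j) * l)
          < ((i0.1 : Fin N) : ℕ) * 2 ^ (b * l - d) / 2 ^ ((b - j) * l)
      have hD0 : ∀ i, ¬ D i 0 := by
        intro i hi
        have h1 := (blockVal_facts hdl 0 ((i0.1 : Fin N) : ℕ)).1 (by rw [← hN]; exact i0.1.isLt)
        have hi' := hi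
        simp only [D] at hi'
        simp only at h1
        rw [h1] at hi'
        exact absurd hi' (Nat.not_lt_zero _)
      have hrnd := init_state (P := P) (D := D) (i0 := i0) hX hY hkX hD0 (by omega) (by omega)
        (hS i0.1 (hS' i0.2))
      obtain ⟨s, g1, g2, g3⟩ := blocks_end hb0 hrnd hq hw he
        (fun i j hj h1 h2 =>
          (blockVal_facts hdl ((i.1 : Fin N) : ℕ) ((i0.1 : Fin N) : ℕ)).2.2 j hj h1 h2)
        hιc rfl hℓ0 hε (by omega) (by
          have : b * (2 * ((h ^ 2 + 12) * ℓ)) = 2 * (b * ((h ^ 2 + 12) * ℓ)) := by ring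
          omega) hrl
        (fun j => by
          have h1 : blockVal d l b (i0.1 : ℕ) j < 2 ^ l := Nat.mod_lt _ (by positivity)
          exact lt_of_lt_of_le h1 hh.ge)
      have hZ : ∀ i : ↥S', (fun x y => SSR d l b Extq Extw Ext x y i.1)
          = P.R i (b - 1) (P.ind i (b - 1)) := by
        intro i
        funext x y
        exact SSR_eq d l b P (fun i => i.1) (fun _ _ => rfl) (fun _ _ => rfl) x y i
      refine ⟨s, g1, fun i hi => ?_, ?_⟩
      · show Kn s (fun x y => SSR d l b Extq Extw Ext x y i.1)
        rw [hZ i]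
        refine g2 i ?_
        exact (blockVal_facts hdl ((i.1 : Fin N) : ℕ) ((i0.1 : Fin N) : ℕ)).2.1 hi
      · show UnifX s (fun x y => SSR d l b Extq Extw Ext x y i0.1)
        rw [hZ i0]
        exact g3)
  rw [hιc] at main
  refine le_trans (le_of_eq ?_) (main.trans (le_of_eq ?_))
  · congr!
  · ring
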